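/- Let G be a finite group and 𝒫 a set of real-valued generalised characters of G satisfying: (1) τ + τ̄ ∈ 𝒫 for every generalised character τ of G of degree 0; (2) Ind_H^G(τ − 1_H − det τ) ∈ 𝒫 for every subgroup H ≤ G and every degree-2 character τ of H that factors through a quotient of H isomorphic to C₂×C₂, D₈, or D_{2p} for an odd prime p; (3) if τᵢ ∈ 𝒫 and nᵢ ∈ ℤ then Σᵢ nᵢτᵢ ∈ 𝒫. Then 𝒫 contains every permutation character of G of degree 0 and trivial determinant. -/

import Mathlib

open scoped Classical

noncomputable section

/-- The complex conjugate of a complex-valued function. -/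
def conjFun {G : Type} (f : G → ℂ) : G → ℂ := fun g => starRingEnd ℂ (f g)

/-- Induction of class functions from a subgroup `H` of `G` to `G`. -/
def indChar {G : Type} [Group G] [Fintype G] (H : Subgroup G) (f : ↥H → ℂ) : G → ℂ :=
  fun g => (Nat.card H : ℂ)⁻¹ *
    ∑ x : G, if h : x⁻¹ * g * x ∈ H then f ⟨x⁻¹ * g * x, h⟩ else 0

/-- The determinant (linear) character of a finite-dimensional complex representation. -/
def detRep {G : Type} [Group G] (V : FDRep ℂ G) : G → ℂ := fun g => LinearMap.det (V.ρ g)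

/-- `f` is the character of some finite-dimensional complex representation of `G`. -/
def IsChar {G : Type} [Group G] (f : G → ℂ) : Prop := ∃ V : FDRep ℂ G, V.character = f

/-- A generalised (virtual) character: a `ℤ`-linear combination of characters. -/
def IsGenChar {G : Type} [Group G] (f : G → ℂ) : Prop :=
  f ∈ Submodule.span ℤ {f : G → ℂ | IsChar f}

/-- A generalised character has trivial determinant: writing `f = χ_V - χ_W`,
`det V ⊗ conj (det W)` is the trivial character. -/
def HasTrivialDet {G : Type} [Group G] (f : G → ℂ) : Prop :=
  ∃ V W : FDRep ℂ G, f = V.character - W.character ∧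
    ∀ g, detRep V g * starRingEnd ℂ (detRep W g) = 1

/-- A permutation character: a `ℤ`-linear combination of characters `Ind_H^G 1_H`. -/
def IsPermChar {G : Type} [Group G] [Fintype G] (f : G → ℂ) : Prop :=
  f ∈ Submodule.span ℤ {f : G → ℂ | ∃ H : Subgroup G, f = indChar H 1}

/-- `𝒮_G`: permutation characters of `G` of degree `0` and trivial determinant. -/
def SG (G : Type) [Group G] [Fintype G] : Set (G → ℂ) :=
  {f | IsPermChar f ∧ f 1 = 0 ∧ HasTrivialDet f}

/-- `Q` is isomorphic to `C₂ × C₂`, to `D₈`, or to `D_{2p}` for an odd prime `p`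
(`DihedralGroup m` is the dihedral group of order `2m`). -/
def IsTargetGroup (Q : Type) [Group Q] : Prop :=
  Nonempty (Q ≃* Multiplicative (ZMod 2 × ZMod 2)) ∨ Nonempty (Q ≃* DihedralGroup 4) ∨
    ∃ p : ℕ, Odd p ∧ p.Prime ∧ Nonempty (Q ≃* DihedralGroup p)

/-- `𝒫_G`: the smallest set of generalised characters of `G` containing `τ + τ̄` for every
generalised character `τ` of degree 0, containing `Ind_H^G (τ - 1 - det τ)` for every degree-2
character `τ` of a subgroup `H` factoring through a quotient of `H` isomorphic to `C₂ × C₂`,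
`D₈` or `D_{2p}` (`p` an odd prime), and closed under `ℤ`-linear combinations. -/
inductive memP (G : Type) [Group G] [Fintype G] : (G → ℂ) → Prop
  | conj_add (τ : G → ℂ) (hτ : IsGenChar τ) (hdeg : τ 1 = 0) : memP G (τ + conjFun τ)
  | ind (H : Subgroup G) (N : Subgroup ↥H) [hN : N.Normal] (V : FDRep ℂ ↥H)
      (hdeg : V.character 1 = 2) (htarget : IsTargetGroup (↥H ⧸ N))
      (hfactors : ∀ n : ↥H, n ∈ N → V.ρ n = 1) :
      memP G (indChar H (V.character - 1 - detRep V))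
  | zero : memP G 0
  | add (f₁ f₂ : G → ℂ) (h₁ : memP G f₁) (h₂ : memP G f₂) : memP G (f₁ + f₂)
  | neg (f : G → ℂ) (h : memP G f) : memP G (-f)

/-- `𝒫_G` as a set. -/
def PG (G : Type) [Group G] [Fintype G] : Set (G → ℂ) := {f | memP G f}

end

noncomputable section

namespace PermDet

set_option linter.unusedSectionVars false

variable {H K G : Type} [Group H] [Fintype H] [Group K] [Fintype K] [Group G] [Fintype G]

/-- Induction of complex functions along a homomorphism of finite groups. -/
def ind (φ : H →* G) : (H → ℂ) →ₗ[ℂ] (G → ℂ) where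
  toFun f g := (Fintype.card H : ℂ)⁻¹ * ∑ x : G, ∑ h : H, if φ h = x⁻¹ * g * x then f h else 0
  map_add' f₁ f₂ := by
    ext g
    simp only [Pi.add_apply, ← mul_add, ← Finset.sum_add_distrib]
    congr 1
    refine Finset.sum_congr rfl fun x _ => Finset.sum_congr rfl fun h _ => ?_
    split_ifs <;> simp
  map_smul' c f := by
    ext g
    simp only [Pi.smul_apply, smul_eq_mul, RingHom.id_apply, Finset.mul_sum]
    refine Finset.sum_congr rfl fun x _ => Finset.sum_congr rfl fun h _ => ?_
    split_ifs <;> ring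

theorem ind_apply (φ : H →* G) (f : H → ℂ) (g : G) : ind φ f g =
    (Fintype.card H : ℂ)⁻¹ * ∑ x : G, ∑ h : H, if φ h = x⁻¹ * g * x then f h else 0 := rfl

theorem card_ne_zero : (Fintype.card G : ℂ) ≠ 0 := Nat.cast_ne_zero.2 Fintype.card_ne_zero

theorem ind_ind (φ : H →* K) (ψ : K →* G) (f : H → ℂ) :
    ind ψ (ind φ f) = ind (ψ.comp φ) f := by
  ext g
  have key : ∀ (y : K) (h : H), (∑ x : G, ∑ k : K,
      if ψ k = x⁻¹ * g * x then (if φ h = y⁻¹ * k * y then f h else 0) else 0) =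
      ∑ x : G, if (ψ.comp φ) h = x⁻¹ * g * x then f h else 0 := by
    intro y h
    rw [← Equiv.sum_comp (Equiv.mulRight (ψ y)⁻¹)]
    refine Finset.sum_congr rfl fun x _ => ?_
    rw [Finset.sum_eq_single (y * φ h * y⁻¹)]
    · have h₁ : φ h = y⁻¹ * (y * φ h * y⁻¹) * y := by group
      rw [if_pos h₁]
      simp only [map_mul, map_inv, Equiv.coe_mulRight, mul_inv_rev, inv_inv,
        MonoidHom.comp_apply, mul_assoc, mul_right_inj]
      simp only [← mul_assoc, mul_left_inj]
    · intro k _ hk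
      have : φ h ≠ y⁻¹ * k * y := fun e => hk (by rw [e]; group)
      simp [this]
    · simp
  calc ind ψ (ind φ f) g
      = (Fintype.card K : ℂ)⁻¹ * ((Fintype.card H : ℂ)⁻¹ * ∑ y : K, ∑ h : H, ∑ x : G, ∑ k : K,
          if ψ k = x⁻¹ * g * x then (if φ h = y⁻¹ * k * y then f h else 0) else 0) := by
        rw [ind_apply]
        congr 1
        have : ∀ (x : G) (k : K), (if ψ k = x⁻¹ * g * x then ind φ f k else 0) =
            (Fintype.card H : ℂ)⁻¹ * ∑ y : K, ∑ h : H,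
            if ψ k = x⁻¹ * g * x then (if φ h = y⁻¹ * k * y then f h else 0) else 0 := by
          intro x k
          split_ifs
          · rfl
          · simp
        simp_rw [this, ← Finset.mul_sum]
        congr 1
        rw [Finset.sum_comm' (t' := Finset.univ) (s' := fun _ => Finset.univ) (by simp)]
        calc _ = ∑ k : K, ∑ x : G, ∑ y : K, ∑ h : H,
              (if ψ k = x⁻¹ * g * x then if φ h = y⁻¹ * k * y then f h else 0 else 0) := rfl
          _ = ∑ k : K, ∑ y : K, ∑ x : G, ∑ h : H,
              (if ψ k = x⁻¹ * g * x then if φ h = y⁻¹ * k * y then f h else 0 else 0) :=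
            Finset.sum_congr rfl fun _ _ => Finset.sum_comm
          _ = ∑ y : K, ∑ k : K, ∑ x : G, ∑ h : H,
              (if ψ k = x⁻¹ * g * x then if φ h = y⁻¹ * k * y then f h else 0 else 0) :=
            Finset.sum_comm
          _ = _ := by
            refine Finset.sum_congr rfl fun y _ => ?_
            calc _ = ∑ x : K, ∑ h : H, ∑ z : G, _ :=
                  Finset.sum_congr rfl fun _ _ => Finset.sum_comm
              _ = _ := Finset.sum_comm
              _ = _ := Finset.sum_congr rfl fun _ _ => Finset.sum_comm
    _ = ind (ψ.comp φ) f g := by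
        simp_rw [key]
        rw [ind_apply, Finset.sum_const, Finset.card_univ, nsmul_eq_mul, Finset.sum_comm]
        field_simp [card_ne_zero (G := K)]

theorem ind_eq_indChar {φ : H →* G} (hφ : Function.Injective φ) (f : H → ℂ) :
    ind φ f = indChar φ.range (fun y => f ((φ.ofInjective hφ).symm y)) := by
  ext g
  rw [ind_apply, indChar, Nat.card_congr (φ.ofInjective hφ).symm.toEquiv, Nat.card_eq_fintype_card]
  congr 1
  refine Finset.sum_congr rfl fun x _ => ?_
  split_ifs with h
  · obtain ⟨y, hy⟩ := h
    rw [Finset.sum_eq_single y]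
    · simp only [hy, if_true]
      congr 1
      rw [MulEquiv.eq_symm_apply]
      exact Subtype.ext hy
    · intro z _ hz
      rw [if_neg fun e => hz (hφ (e.trans hy.symm))]
    · simp
  · exact Finset.sum_eq_zero fun y _ => if_neg fun e => h ⟨y, e⟩

theorem ind_subtype (L : Subgroup G) (f : L → ℂ) : ind L.subtype f = indChar L f := by
  ext g
  rw [ind_apply, indChar, Nat.card_eq_fintype_card]
  congr 1
  refine Finset.sum_congr rfl fun x _ => ?_
  split_ifs with h
  · rw [Finset.sum_eq_single ⟨_, h⟩]
    · simp
    · intro z _ hz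
      rw [if_neg fun e => hz (Subtype.ext (by exact e))]
    · simp
  · refine Finset.sum_eq_zero fun y _ => if_neg fun e => h ?_
    rw [← e]; exact y.2

theorem ind_one {φ : H →* G} (hφ : Function.Injective φ) (f : H → ℂ) :
    ind φ f 1 = (Fintype.card H : ℂ)⁻¹ * (Fintype.card G * f 1) := by
  rw [ind_apply]
  congr 1
  have : ∀ h : H, φ h = 1 ↔ h = 1 := fun h => map_eq_one_iff φ hφ
  simp [this]

theorem conjFun_ind (φ : H →* G) (f : H → ℂ) : conjFun (ind φ f) = ind φ (conjFun f) := by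
  ext g
  simp only [conjFun, ind_apply, map_mul, map_inv₀, map_natCast, map_sum]
  congr! 3
  split_ifs <;> simp

theorem conjFun_add (f₁ f₂ : G → ℂ) : conjFun (f₁ + f₂) = conjFun f₁ + conjFun f₂ := by
  ext; simp [conjFun]

theorem conjFun_neg (f : G → ℂ) : conjFun (-f) = -conjFun f := by
  ext; simp [conjFun]

/-- `f` is constant on conjugacy classes. -/
def IsClassFun (f : G → ℂ) : Prop := ∀ x g, f (x⁻¹ * g * x) = f g

theorem isClassFun_ind (φ : H →* G) (f : H → ℂ) : IsClassFun (ind φ f) := by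
  intro y g
  rw [ind_apply, ind_apply]
  congr 1
  refine Fintype.sum_equiv (Equiv.mulLeft y) _ _ fun x => ?_
  simp [mul_assoc]

theorem ind_mul_comp (φ : H →* G) (f : H → ℂ) {F : G → ℂ} (hF : IsClassFun F) :
    ind φ (fun h => f h * F (φ h)) = ind φ f * F := by
  ext g
  simp only [ind_apply, Pi.mul_apply, mul_assoc, Finset.sum_mul]
  congr 1
  refine Finset.sum_congr rfl fun x _ => Finset.sum_congr rfl fun h _ => ?_
  split_ifs with e
  · rw [e, ← mul_assoc, hF]
  · simp

theorem ind_id {f : G → ℂ} (hf : IsClassFun f) : ind (MonoidHom.id G) f = f := by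
  ext g
  rw [ind_apply]
  simp only [MonoidHom.id_apply, Finset.sum_ite_eq', Finset.mem_univ, if_true, hf _ g]
  simp

/-- If `f` is the character of a representation, `mult u g f` is the multiplicity of `u⁻¹` as an
eigenvalue of `g`, for `u` a root of unity of order dividing `2 * orderOf g`. -/
def mult (u : ℂ) (g : G) : (G → ℂ) →ₗ[ℂ] ℂ where
  toFun f := (2 * orderOf g : ℂ)⁻¹ * ∑ k ∈ Finset.range (2 * orderOf g), u ^ k * f (g ^ k)
  map_add' f₁ f₂ := by simp [mul_add, Finset.sum_add_distrib]
  map_smul' c f := by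
    simp only [Pi.smul_apply, smul_eq_mul, RingHom.id_apply, Finset.mul_sum]
    refine Finset.sum_congr rfl fun k _ => ?_
    ring

theorem mult_apply (u : ℂ) (g : G) (f : G → ℂ) : mult u g f =
    (2 * orderOf g : ℂ)⁻¹ * ∑ k ∈ Finset.range (2 * orderOf g), u ^ k * f (g ^ k) := rfl

theorem orderOf_ne_zero' (g : G) : (orderOf g : ℂ) ≠ 0 :=
  Nat.cast_ne_zero.2 (ne_of_gt (orderOf_pos g))

/-- Class functions all of whose multiplicities of `±1` are integers divisible by `m`. -/
def multsIn (m : ℤ) (G : Type) [Group G] [Fintype G] : AddSubgroup (G → ℂ) where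
  carrier := {f | IsClassFun f ∧ ∀ (g : G) (u : ℂ), u ^ 2 = 1 → ∃ n : ℤ, mult u g f = m * n}
  add_mem' := by
    rintro a b ⟨ha, ha'⟩ ⟨hb, hb'⟩
    refine ⟨fun x g => by simp [ha x g, hb x g], fun g u hu => ?_⟩
    obtain ⟨n, hn⟩ := ha' g u hu
    obtain ⟨k, hk⟩ := hb' g u hu
    exact ⟨n + k, by rw [map_add, hn, hk]; push_cast; ring⟩
  zero_mem' := ⟨fun x g => rfl, fun g u _ => ⟨0, by simp⟩⟩
  neg_mem' := by
    rintro a ⟨ha, ha'⟩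
    refine ⟨fun x g => by simp [ha x g], fun g u hu => ?_⟩
    obtain ⟨n, hn⟩ := ha' g u hu
    exact ⟨-n, by rw [map_neg, hn]; push_cast; ring⟩

theorem sum_mem_of_minimalPeriod {X : Type} [Fintype X] [MulAction G X] (g : G) (c : X → ℂ)
    (hc : ∀ x, c (g • x) = c x) (A : AddSubgroup ℂ)
    (hA : ∀ x, (Function.minimalPeriod (g • ·) x : ℂ) * c x ∈ A) : ∑ x, c x ∈ A := by
  have hz : ∀ (z : Subgroup.zpowers g) x, c (z • x) = c x := by
    rintro ⟨_, n, rfl⟩ x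
    have hnat : ∀ (n : ℕ) x, c (g ^ n • x) = c x := by
      intro n
      induction n with
      | zero => simp
      | succ n ih => intro x; rw [pow_succ, mul_smul, ih, hc]
    obtain ⟨n, rfl | rfl⟩ := n.eq_nat_or_neg
    · simpa using hnat n x
    · have := hnat n ((g ^ n)⁻¹ • x)
      rw [smul_inv_smul] at this
      simpa [Subgroup.smul_def] using this.symm
  rw [← (MulAction.selfEquivSigmaOrbits (Subgroup.zpowers g) X).symm.sum_comp,
    Fintype.sum_sigma]
  refine sum_mem fun ω _ => ?_
  have : ∀ y : MulAction.orbit (Subgroup.zpowers g) ω.out,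
      c ((MulAction.selfEquivSigmaOrbits (Subgroup.zpowers g) X).symm ⟨ω, y⟩) = c ω.out := by
    rintro ⟨_, z, rfl⟩
    exact hz z _
  simp_rw [this]
  rw [Finset.sum_const, Finset.card_univ, ← MulAction.minimalPeriod_eq_card, nsmul_eq_mul]
  exact hA _

theorem sum_range_mul_of_dvd {M : Type*} [AddCommMonoid M] (F : ℕ → M) {d : ℕ} (hd : 0 < d) (n : ℕ)
    (hF : ∀ k, ¬ d ∣ k → F k = 0) :
    ∑ k ∈ Finset.range (d * n), F k = ∑ j ∈ Finset.range n, F (d * j) := by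
  rw [← Finset.sum_image (s := Finset.range n) (g := fun j => d * j) (f := F)
    fun a _ b _ h => Nat.eq_of_mul_eq_mul_left hd h]
  symm
  refine Finset.sum_subset ?_ fun k hk hk' => hF k ?_
  · intro k hk
    obtain ⟨j, hj, rfl⟩ := Finset.mem_image.1 hk
    exact Finset.mem_range.2 (Nat.mul_lt_mul_of_pos_left (Finset.mem_range.1 hj) hd)
  · rintro ⟨j, rfl⟩
    exact hk' (Finset.mem_image.2 ⟨j, Finset.mem_range.2
      (Nat.lt_of_mul_lt_mul_left (Finset.mem_range.1 hk)), rfl⟩)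

theorem sum_quotient_mk (L : Subgroup G) [Fintype (G ⧸ L)] (F : G ⧸ L → ℂ) :
    ∑ x : G, F x = Nat.card L * ∑ q, F q := by
  rw [← (Subgroup.groupEquivQuotientProdSubgroup (s := L)).symm.sum_comp, Fintype.sum_prod_type,
    Finset.mul_sum]
  refine Finset.sum_congr rfl fun q _ => ?_
  have : ∀ l : L, F ((Subgroup.groupEquivQuotientProdSubgroup (s := L)).symm (q, l) : G) = F q := by
    intro l
    congr 1
    have h := (Subgroup.groupEquivQuotientProdSubgroup (s := L)).apply_symm_apply (q, l)
    exact congrArg Prod.fst h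
  simp_rw [this]
  simp

theorem ind_mem_multsIn {m : ℤ} {φ : H →* G} (hφ : Function.Injective φ) {f : H → ℂ}
    (hf : f ∈ multsIn m H) : ind φ f ∈ multsIn m G := by
  refine ⟨isClassFun_ind φ f, fun g u hu => ?_⟩
  set E : G → ℂ := fun y => ∑ h, if φ h = y then f h else 0 with hE
  have hEφ : ∀ h, E (φ h) = f h := fun h => by
    simp only [hE]
    rw [Finset.sum_eq_single h] <;> simp +contextual [hφ.eq_iff]
  have hE0 : ∀ y, y ∉ φ.range → E y = 0 := fun y hy =>
    Finset.sum_eq_zero fun h _ => if_neg fun e => hy ⟨h, e⟩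
  have hEc : ∀ y h, E ((φ h)⁻¹ * y * φ h) = E y := by
    intro y h
    by_cases hy : y ∈ φ.range
    · obtain ⟨k, rfl⟩ := hy
      rw [← map_inv, ← map_mul, ← map_mul, hEφ, hEφ, hf.1]
    · rw [hE0 y hy, hE0]
      contrapose! hy
      have := φ.range.mul_mem (φ.range.mul_mem (⟨h, rfl⟩ : φ h ∈ φ.range) hy)
        (φ.range.inv_mem ⟨h, rfl⟩)
      rwa [show φ h * ((φ h)⁻¹ * y * φ h) * (φ h)⁻¹ = y by group] at this
  set L := φ.range
  set o := orderOf g with ho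
  set c : G → ℂ := fun x => (2 * o : ℂ)⁻¹ *
    ∑ k ∈ Finset.range (2 * o), u ^ k * E (x⁻¹ * g ^ k * x) with hcdef
  have hcL : ∀ x, ∀ l ∈ L, c (x * l) = c x := by
    rintro x _ ⟨h, rfl⟩
    simp only [hcdef]
    congr 1
    refine Finset.sum_congr rfl fun k _ => ?_
    rw [← hEc (x⁻¹ * g ^ k * x) h]
    simp [mul_assoc]
  set c' : G ⧸ L → ℂ := fun q => c q.out with hc'
  have hcc' : ∀ x : G, c' x = c x := by
    intro x
    obtain ⟨l, hl⟩ := QuotientGroup.mk_out_eq_mul L x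
    simp only [hc', hl]
    exact hcL x _ l.2
  have h1 : mult u g (ind φ f) = ∑ q, c' q := by
    have h2 := sum_quotient_mk L c'
    have hcard : Nat.card L = Fintype.card H := by
      rw [← Nat.card_eq_fintype_card]
      exact Nat.card_congr (φ.ofInjective hφ).symm.toEquiv
    rw [hcard] at h2
    rw [eq_comm, ← mul_right_inj' (card_ne_zero (G := H)), ← h2]
    simp_rw [hcc', hcdef, mult_apply, ind_apply]
    rw [← Finset.mul_sum, Finset.sum_comm, mul_left_comm,
      Finset.mul_sum (a := (Fintype.card H : ℂ))]
    congr 1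
    refine Finset.sum_congr rfl fun k _ => ?_
    rw [← Finset.mul_sum, mul_left_comm, mul_inv_cancel_left₀ card_ne_zero]
  have hmem : ∑ q, c' q ∈ (AddSubgroup.zmultiples (m : ℂ)) := by
    refine sum_mem_of_minimalPeriod g c' ?_ _ ?_
    · intro q
      obtain ⟨x, rfl⟩ := QuotientGroup.mk_surjective q
      rw [← MulAction.Quotient.coe_smul_out, hcc', hcc' x, smul_eq_mul]
      obtain ⟨l, hl⟩ := QuotientGroup.mk_out_eq_mul L x
      rw [hl, ← mul_assoc, hcL _ _ l.2]
      simp only [hcdef]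
      congr 1
      refine Finset.sum_congr rfl fun k _ => ?_
      congr 2
      rw [mul_inv_rev]
      have : g⁻¹ * g ^ k * g = g ^ k := by rw [mul_assoc, ← pow_succ, pow_succ']; group
      rw [← mul_assoc, mul_assoc x⁻¹, mul_assoc x⁻¹ , this]
    · intro q
      obtain ⟨x, rfl⟩ := QuotientGroup.mk_surjective q
      rw [hcc']
      set d := Function.minimalPeriod (g • ·) (x : G ⧸ L) with hd
      have hperiod : ∀ k, x⁻¹ * g ^ k * x ∈ L ↔ d ∣ k := by
        intro k
        rw [hd, ← MulAction.pow_smul_eq_iff_minimalPeriod_dvd]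
        change _ ↔ ((g ^ k * x : G) : G ⧸ L) = x
        rw [eq_comm, QuotientGroup.eq, mul_assoc]
      have hdo : d ∣ o := by
        rw [← hperiod, ho, pow_orderOf_eq_one]
        simp
      have hopos : 0 < o := orderOf_pos g
      have hdpos : 0 < d := Nat.pos_of_dvd_of_pos hdo hopos
      obtain ⟨h, hh⟩ := (hperiod d).2 dvd_rfl
      have hconj : ∀ k, x⁻¹ * g ^ k * x = (x⁻¹ * g * x) ^ k := fun k => by
        simpa using (conj_pow (i := k) (a := x⁻¹) (b := g)).symm
      have hord : d * orderOf h = o := by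
        have h3 : orderOf (x⁻¹ * g * x) = o := by
          have := (MulAut.conj x⁻¹).orderOf_eq g
          simpa using this
        rw [← orderOf_injective φ hφ, hh, hconj, orderOf_pow, h3, Nat.gcd_eq_right hdo,
          Nat.mul_div_cancel' hdo]
      obtain ⟨n, hn⟩ := hf.2 h (u ^ d) (by rw [← pow_mul, mul_comm, pow_mul, hu, one_pow])
      refine AddSubgroup.mem_zmultiples_iff.2 ⟨n, ?_⟩
      rw [zsmul_eq_mul, mul_comm, ← hn, mult_apply]
      simp only [hcdef]
      have h4 : 2 * o = d * (2 * orderOf h) := by rw [← hord]; ring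
      rw [h4, sum_range_mul_of_dvd _ hdpos]
      · have h5 : ∀ j, E (x⁻¹ * g ^ (d * j) * x) = f (h ^ j) := by
          intro j
          rw [hconj, pow_mul, ← hconj, ← hh, ← map_pow, hEφ]
        simp_rw [h5, pow_mul]
        have h6 : (o : ℂ) = d * orderOf h := by rw [← hord]; push_cast; ring
        have h7 : (d : ℂ) ≠ 0 := Nat.cast_ne_zero.2 hdpos.ne'
        have h8 := orderOf_ne_zero' h
        rw [h6]
        field_simp
      · intro k hk
        rw [hE0 _ (fun h => hk ((hperiod k).1 h)), mul_zero]
  obtain ⟨n, hn⟩ := AddSubgroup.mem_zmultiples_iff.1 hmem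
  exact ⟨n, by rw [h1, ← hn, zsmul_eq_mul, mul_comm]⟩

theorem mult_of_pow {u : ℂ} (hu : u ^ 2 = 1) {g : G} {f : G → ℂ} {a : ℂ}
    (hf : ∀ k, f (g ^ k) = a ^ k) : mult u g f = if u * a = 1 then 1 else 0 := by
  have ha : a ^ (orderOf g) = 1 := by
    rw [← hf, pow_orderOf_eq_one, ← pow_zero g, hf, pow_zero]
  have h2 : (u * a) ^ (2 * orderOf g) = 1 := by
    rw [mul_pow, pow_mul u, hu, mul_comm 2, pow_mul, ha]; simp
  rw [mult_apply]
  simp_rw [hf, ← mul_pow]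
  split_ifs with h
  · have := orderOf_ne_zero' g
    rw [h]
    simp
    field_simp
  · have h3 := geom_sum_mul (u * a) (2 * orderOf g)
    rw [h2, sub_self] at h3
    rw [(mul_eq_zero.1 h3).resolve_right (sub_ne_zero.2 h), mul_zero]

theorem mult_monoidHom {u : ℂ} (hu : u ^ 2 = 1) (g : G) (l : G →* ℂ) :
    mult u g l = if u * l g = 1 then 1 else 0 :=
  mult_of_pow hu fun k => by rw [map_pow]

theorem mult_one {u : ℂ} (hu : u ^ 2 = 1) (g : G) :
    mult u g 1 = if u = 1 then 1 else 0 := by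
  rw [mult_of_pow hu (a := 1) (by simp), mul_one]

theorem isClassFun_monoidHom (l : G →* ℂ) : IsClassFun l := by
  intro x g
  rw [map_mul, map_mul, mul_right_comm, ← map_mul]
  simp

theorem mult_conjFun {u : ℂ} (hu : u ^ 2 = 1) (g : G) (f : G → ℂ) :
    mult u g (conjFun f) = starRingEnd ℂ (mult u g f) := by
  have : starRingEnd ℂ u = u := by
    rcases sq_eq_sq_iff_eq_or_eq_neg.1 (hu.trans (one_pow 2).symm) with rfl | rfl <;> simp
  simp [mult_apply, conjFun, this, Complex.conj_ofNat]

/-- The group of generalised monomial characters. -/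
def mono (G : Type) [Group G] [Fintype G] : AddSubgroup (G → ℂ) :=
  AddSubgroup.closure {f | ∃ (H : Type) (_ : Group H) (_ : Fintype H) (φ : H →* G) (l : H →* ℂ),
    Function.Injective φ ∧ f = ind φ l}

theorem ind_mem_mono {φ : H →* G} (hφ : Function.Injective φ) (l : H →* ℂ) :
    ind φ l ∈ mono G :=
  AddSubgroup.subset_closure ⟨H, _, _, φ, l, hφ, rfl⟩

theorem monoidHom_mem_mono (l : G →* ℂ) : (l : G → ℂ) ∈ mono G := by
  rw [← ind_id (isClassFun_monoidHom l)]
  exact ind_mem_mono Function.injective_id l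

theorem one_mem_mono : (1 : G → ℂ) ∈ mono G := monoidHom_mem_mono 1

theorem ind_mono {φ : H →* G} (hφ : Function.Injective φ) {f : H → ℂ} (hf : f ∈ mono H) :
    ind φ f ∈ mono G := by
  induction hf using AddSubgroup.closure_induction with
  | mem f hf =>
    obtain ⟨L, _, _, ψ, l, hψ, rfl⟩ := hf
    rw [ind_ind]
    exact ind_mem_mono (φ := φ.comp ψ) (hφ.comp hψ) l
  | zero => rw [map_zero]; exact zero_mem _
  | add a b _ _ ha hb => rw [map_add]; exact add_mem ha hb
  | neg a _ ha => rw [map_neg]; exact neg_mem ha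

theorem mono_le_multsIn : mono G ≤ multsIn 1 G := by
  refine (AddSubgroup.closure_le _).2 ?_
  rintro _ ⟨H, _, _, φ, l, hφ, rfl⟩
  refine ind_mem_multsIn hφ ⟨isClassFun_monoidHom l, fun g u hu => ?_⟩
  rw [mult_monoidHom hu]
  split_ifs
  · exact ⟨1, by simp⟩
  · exact ⟨0, by simp⟩

/-- A sign character as a complex function. -/
def sgn (ε : G →* ℤˣ) : G → ℂ := fun g => ((ε g : ℤ) : ℂ)

/-- A sign character as a complex linear character. -/
def sgnHom (ε : G →* ℤˣ) : G →* ℂ :=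
  ((Int.castRingHom ℂ : ℤ →* ℂ).comp (Units.coeHom ℤ)).comp ε

theorem sgn_eq (ε : G →* ℤˣ) : sgn ε = sgnHom ε := rfl

theorem sgn_mem_mono (ε : G →* ℤˣ) : sgn ε ∈ mono G := monoidHom_mem_mono (sgnHom ε)

@[simp] theorem sgn_one : sgn (1 : G →* ℤˣ) = 1 := by ext; simp [sgn]

@[simp] theorem sgn_apply_one (ε : G →* ℤˣ) : sgn ε 1 = 1 := by simp [sgn]

theorem conjFun_sgn (ε : G →* ℤˣ) : conjFun (sgn ε) = sgn ε := by
  ext; simp [conjFun, sgn]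

theorem conjFun_one : conjFun (1 : G → ℂ) = 1 := by ext; simp [conjFun]

/-- For `τ` the two-dimensional representation of a dihedral group on which the rotations act
through `ψ` and `ψ⁻¹`, the function `τ - 1 - det τ`. -/
def dih {n : ℕ} (ψ : AddChar (ZMod n) ℂ) : DihedralGroup n → ℂ
  | DihedralGroup.r i => ψ i + ψ (-i) - 2
  | DihedralGroup.sr _ => 0

/-- Generators of the group of virtual characters to which the theorem reduces everything. -/
inductive Gen (G : Type) [Group G] [Fintype G] : (G → ℂ) → Prop
  | conj (τ : G → ℂ) (hτ : τ ∈ mono G) (h0 : τ 1 = 0) : Gen G (τ + conjFun τ)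
  | quad (H : Type) [Group H] [Fintype H] (φ : H →* G) (hφ : Function.Injective φ)
      (ε₁ ε₂ : H →* ℤˣ) : Gen G (ind φ (sgn ε₁ + sgn ε₂ - 1 - sgn (ε₁ * ε₂)))
  | dih (H : Type) [Group H] [Fintype H] (φ : H →* G) (hφ : Function.Injective φ) (n : ℕ)
      (hn : n = 4 ∨ Odd n ∧ n.Prime) (d : H →* DihedralGroup n) (hd : Function.Surjective d)
      (ψ : AddChar (ZMod n) ℂ) : Gen G (ind φ (fun h => dih ψ (d h)))

/-- The group generated by `Gen G`. -/
def PP (G : Type) [Group G] [Fintype G] : AddSubgroup (G → ℂ) :=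
  AddSubgroup.closure {f | Gen G f}

theorem conj_mem_PP {τ : G → ℂ} (hτ : τ ∈ mono G) (h0 : τ 1 = 0) : τ + conjFun τ ∈ PP G :=
  AddSubgroup.subset_closure (Gen.conj τ hτ h0)

theorem two_mem_PP {τ : G → ℂ} (hτ : τ ∈ mono G) (h0 : τ 1 = 0) (hr : conjFun τ = τ) :
    2 • τ ∈ PP G := by
  have := conj_mem_PP hτ h0
  rwa [hr, ← two_nsmul] at this

theorem quad_isClassFun (ε₁ ε₂ : G →* ℤˣ) :
    IsClassFun (sgn ε₁ + sgn ε₂ - 1 - sgn (ε₁ * ε₂)) := by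
  intro x g
  have := fun ε : G →* ℤˣ => isClassFun_monoidHom (sgnHom ε) x g
  simp only [sgn_eq, Pi.add_apply, Pi.sub_apply, Pi.one_apply, this]

theorem quad_mem_PP (ε₁ ε₂ : G →* ℤˣ) : sgn ε₁ + sgn ε₂ - 1 - sgn (ε₁ * ε₂) ∈ PP G := by
  rw [← ind_id (quad_isClassFun ε₁ ε₂)]
  exact AddSubgroup.subset_closure (Gen.quad G _ Function.injective_id _ _)

theorem dih_isClassFun {n : ℕ} (d : G →* DihedralGroup n) (ψ : AddChar (ZMod n) ℂ) :
    IsClassFun (fun h => dih ψ (d h)) := by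
  intro x g
  simp only [map_mul, map_inv]
  generalize d x = a
  generalize d g = b
  rcases a with i | i <;> rcases b with j | j <;>
    simp [dih, DihedralGroup.r_mul_r, DihedralGroup.r_mul_sr, DihedralGroup.sr_mul_r,
      DihedralGroup.sr_mul_sr, add_comm]

theorem dih_mem_PP {n : ℕ} (hn : n = 4 ∨ Odd n ∧ n.Prime) (d : G →* DihedralGroup n)
    (hd : Function.Surjective d) (ψ : AddChar (ZMod n) ℂ) : (fun h => dih ψ (d h)) ∈ PP G := by
  rw [← ind_id (dih_isClassFun d ψ)]
  exact AddSubgroup.subset_closure (Gen.dih G _ Function.injective_id n hn d hd ψ)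

theorem ind_mem_PP {φ : H →* G} (hφ : Function.Injective φ) {f : H → ℂ} (hf : f ∈ PP H) :
    ind φ f ∈ PP G := by
  induction hf using AddSubgroup.closure_induction with
  | mem f hf =>
    rcases hf with ⟨τ, hτ, h0⟩ | ⟨L, ψ, hψ, ε₁, ε₂⟩ | ⟨L, ψ, hψ, n, hn, d, hd, χ⟩
    · rw [map_add, ← conjFun_ind]
      exact conj_mem_PP (ind_mono hφ hτ) (by rw [ind_one hφ, h0]; simp)
    · rw [ind_ind]
      exact AddSubgroup.subset_closure (Gen.quad L (φ.comp ψ) (hφ.comp hψ) _ _)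
    · rw [ind_ind]
      exact AddSubgroup.subset_closure (Gen.dih L (φ.comp ψ) (hφ.comp hψ) n hn d hd χ)
  | zero => rw [map_zero]; exact zero_mem _
  | add a b _ _ ha hb => rw [map_add]; exact add_mem ha hb
  | neg a _ ha => rw [map_neg]; exact neg_mem ha

theorem quad_mem_multsIn (ε₁ ε₂ : G →* ℤˣ) :
    sgn ε₁ + sgn ε₂ - 1 - sgn (ε₁ * ε₂) ∈ multsIn 2 G := by
  refine ⟨quad_isClassFun ε₁ ε₂, fun g u hu => ?_⟩
  have h (ε : G →* ℤˣ) : mult u g (sgn ε) = if u * ((ε g : ℤ) : ℂ) = 1 then 1 else 0 :=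
    mult_monoidHom hu g (sgnHom ε)
  rw [map_sub, map_sub, map_add, h, h, h, mult_one hu]
  have e₁ := Int.units_eq_one_or (ε₁ g)
  have e₂ := Int.units_eq_one_or (ε₂ g)
  rcases e₁ with e₁ | e₁ <;> rcases e₂ with e₂ | e₂ <;>
    rcases sq_eq_sq_iff_eq_or_eq_neg.1 (hu.trans (one_pow 2).symm) with rfl | rfl <;>
    simp only [e₁, e₂, MonoidHom.mul_apply] <;>
    first
    | (refine ⟨0, ?_⟩; norm_num; done)
    | (refine ⟨1, ?_⟩; norm_num; done)
    | (refine ⟨-1, ?_⟩; norm_num)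

theorem dih_mem_multsIn {n : ℕ} (d : G →* DihedralGroup n) (ψ : AddChar (ZMod n) ℂ) :
    (fun h => dih ψ (d h)) ∈ multsIn 2 G := by
  refine ⟨dih_isClassFun d ψ, fun g u hu => ?_⟩
  rcases hdg : d g with i | i
  · have hr : ∀ k : ℕ, d (g ^ k) = DihedralGroup.r ((k : ZMod n) * i) := by
      intro k
      rw [map_pow, hdg]
      induction k with
      | zero => rw [pow_zero, DihedralGroup.one_def]; simp
      | succ k ih => rw [pow_succ, ih, DihedralGroup.r_mul_r]; congr 1; push_cast; ring
    set f₁ : G → ℂ := fun x => match d x with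
      | DihedralGroup.r j => ψ j
      | DihedralGroup.sr _ => 0
    set f₂ : G → ℂ := fun x => match d x with
      | DihedralGroup.r j => ψ (-j)
      | DihedralGroup.sr _ => 0
    have e : mult u g (fun h => dih ψ (d h)) = mult u g (f₁ + f₂ - 1 - 1) := by
      rw [mult_apply, mult_apply]
      congr 1
      refine Finset.sum_congr rfl fun k _ => ?_
      simp only [hr, dih, f₁, f₂, Pi.add_apply, Pi.sub_apply, Pi.one_apply]
      ring
    have h₁ : ∀ k, f₁ (g ^ k) = ψ i ^ k := fun k => by
      simp only [f₁, hr]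
      rw [← AddChar.map_nsmul_eq_pow, nsmul_eq_mul]
    have h₂ : ∀ k, f₂ (g ^ k) = ψ (-i) ^ k := fun k => by
      simp only [f₂, hr]
      rw [← AddChar.map_nsmul_eq_pow, nsmul_eq_mul, mul_neg]
    rw [e, map_sub, map_sub, map_add, mult_of_pow hu h₁, mult_of_pow hu h₂, mult_one hu]
    have hinv : ψ i * ψ (-i) = 1 := by rw [← AddChar.map_add_eq_mul]; simp
    have hiff : u * ψ i = 1 ↔ u * ψ (-i) = 1 := by
      have : (u * ψ i) * (u * ψ (-i)) = 1 := by linear_combination hu * (ψ i * ψ (-i)) + hinv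
      constructor <;> intro h <;> simpa [h] using this
    simp only [hiff]
    refine ⟨(if u * ψ (-i) = 1 then 1 else 0) - (if u = 1 then 1 else 0), ?_⟩
    split_ifs <;> norm_num
  · refine ⟨0, ?_⟩
    rw [mult_apply, Finset.sum_eq_zero, mul_zero, Int.cast_zero, mul_zero]
    intro k _
    have hsq : d g * d g = 1 := by rw [hdg]; simp
    rw [map_pow]
    rcases Nat.even_or_odd' k with ⟨j, rfl | rfl⟩
    · rw [pow_mul (d g), sq, hsq, one_pow, DihedralGroup.one_def]
      simp [dih]
      norm_num
    · rw [pow_succ (d g), pow_mul, sq, hsq, one_pow, one_mul, hdg]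
      simp [dih]

theorem PP_le_multsIn : PP G ≤ multsIn 2 G := by
  refine (AddSubgroup.closure_le _).2 ?_
  rintro _ (⟨τ, hτ, h0⟩ | ⟨L, ψ, hψ, ε₁, ε₂⟩ | ⟨L, ψ, hψ, n, hn, d, hd, χ⟩)
  · have h := mono_le_multsIn hτ
    refine ⟨fun x g => by simp [conjFun, h.1 x g], fun g u hu => ?_⟩
    obtain ⟨n, hn⟩ := h.2 g u hu
    exact ⟨n, by rw [map_add, mult_conjFun hu, hn]; simp; ring⟩
  · exact ind_mem_multsIn hψ (quad_mem_multsIn _ _)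
  · exact ind_mem_multsIn hψ (dih_mem_multsIn _ _)

theorem apply_one_of_mem_PP {f : G → ℂ} (hf : f ∈ PP G) : f 1 = 0 := by
  induction hf using AddSubgroup.closure_induction with
  | mem f hf =>
    rcases hf with ⟨τ, hτ, h0⟩ | ⟨L, ψ, hψ, ε₁, ε₂⟩ | ⟨L, ψ, hψ, n, hn, d, hd, χ⟩
    · simp [conjFun, h0]
    · rw [ind_one hψ]; simp
    · rw [ind_one hψ, map_one, DihedralGroup.one_def]; simp [dih]; norm_num
  | zero => rfl
  | add a b _ _ ha hb => simp [ha, hb]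
  | neg a _ ha => simp [ha]

/-- The permutation character of a finite `G`-set. -/
def fixChar (G X : Type) [Group G] [MulAction G X] [Fintype X] : G → ℂ :=
  fun g => ∑ x : X, if g • x = x then 1 else 0

theorem isClassFun_fixChar (X : Type) [MulAction G X] [Fintype X] :
    IsClassFun (fixChar G X) := by
  intro y g
  simp only [fixChar]
  rw [← Equiv.sum_comp (MulAction.toPerm y⁻¹ : Equiv.Perm X)]
  refine Finset.sum_congr rfl fun x _ => ?_
  simp [mul_smul]

theorem fixChar_quotient (L : Subgroup G) [Fintype (G ⧸ L)] :
    fixChar G (G ⧸ L) = ind L.subtype 1 := by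
  ext g
  have h := sum_quotient_mk L fun q => if g • q = q then 1 else 0
  rw [fixChar, ind_apply, ← Nat.card_eq_fintype_card, eq_inv_mul_iff_mul_eq₀]
  · refine (Eq.trans (by congr!) h.symm).trans ?_
    refine Finset.sum_congr rfl fun x _ => ?_
    have : g • (x : G ⧸ L) = x ↔ x⁻¹ * g * x ∈ L := by
      change ((g * x : G) : G ⧸ L) = x ↔ _
      rw [eq_comm, QuotientGroup.eq, mul_assoc]
    simp only [this, Pi.one_apply, Subgroup.subtype_apply]
    split_ifs with hx
    · rw [Finset.sum_eq_single ⟨_, hx⟩] <;> simp +contextual [Subtype.ext_iff]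
    · rw [Finset.sum_eq_zero]
      rintro ⟨l, hl⟩ _
      exact if_neg fun e => hx (by simpa [← e] using hl)
  · exact_mod_cast (ne_of_gt Nat.card_pos)

/-- The group of generalised permutation characters. -/
def perm (G : Type) [Group G] [Fintype G] : AddSubgroup (G → ℂ) :=
  AddSubgroup.closure {f | ∃ (X : Type) (_ : MulAction G X) (_ : Fintype X), f = fixChar G X}

theorem fixChar_mem_perm (X : Type) [MulAction G X] [Fintype X] : fixChar G X ∈ perm G :=
  AddSubgroup.subset_closure ⟨X, _, _, rfl⟩

theorem ind_one_mem_perm (L : Subgroup G) : ind L.subtype 1 ∈ perm G := by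
  rw [← fixChar_quotient]
  exact fixChar_mem_perm _

theorem mul_mem_perm {f₁ f₂ : G → ℂ} (h₁ : f₁ ∈ perm G) (h₂ : f₂ ∈ perm G) :
    f₁ * f₂ ∈ perm G := by
  induction h₁ using AddSubgroup.closure_induction with
  | mem f hf =>
    obtain ⟨X, _, _, rfl⟩ := hf
    induction h₂ using AddSubgroup.closure_induction with
    | mem f hf =>
      obtain ⟨Y, _, _, rfl⟩ := hf
      convert fixChar_mem_perm (G := G) (X × Y)
      ext g
      simp only [fixChar, Pi.mul_apply, Finset.sum_mul_sum, Fintype.sum_prod_type]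
      refine Finset.sum_congr rfl fun x _ => Finset.sum_congr rfl fun y _ => ?_
      by_cases hx : g • x = x <;> by_cases hy : g • y = y <;> simp [Prod.ext_iff, hx, hy]
    | zero => rw [mul_zero]; exact zero_mem _
    | add a b _ _ ha hb => rw [mul_add]; exact add_mem ha hb
    | neg a _ ha => rw [mul_neg]; exact neg_mem ha
  | zero => rw [zero_mul]; exact zero_mem _
  | add a b _ _ ha hb => rw [add_mul]; exact add_mem ha hb
  | neg a _ ha => rw [neg_mul]; exact neg_mem ha

theorem comp_mem_perm (φ : H →* G) {f : G → ℂ} (hf : f ∈ perm G) :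
    (fun h => f (φ h)) ∈ perm H := by
  induction hf using AddSubgroup.closure_induction with
  | mem f hf =>
    obtain ⟨X, _, _, rfl⟩ := hf
    let _ : MulAction H X := MulAction.compHom X φ
    exact fixChar_mem_perm (G := H) X
  | zero => exact zero_mem _
  | add a b _ _ ha hb => exact add_mem ha hb
  | neg a _ ha => exact neg_mem ha

theorem conjFun_of_mem_perm {f : G → ℂ} (hf : f ∈ perm G) : conjFun f = f := by
  induction hf using AddSubgroup.closure_induction with
  | mem f hf =>
    obtain ⟨X, _, _, rfl⟩ := hf
    ext g
    simp only [conjFun, fixChar, map_sum]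
    refine Finset.sum_congr rfl fun x _ => ?_
    split_ifs <;> simp
  | zero => ext; simp [conjFun]
  | add a b _ _ ha hb => rw [conjFun_add, ha, hb]
  | neg a _ ha => rw [conjFun_neg, ha]

theorem isClassFun_of_mem_perm {f : G → ℂ} (hf : f ∈ perm G) : IsClassFun f := by
  induction hf using AddSubgroup.closure_induction with
  | mem f hf =>
    obtain ⟨X, _, _, rfl⟩ := hf
    exact isClassFun_fixChar X
  | zero => intro x g; rfl
  | add a b _ _ ha hb => intro x g; simp [ha x g, hb x g]
  | neg a _ ha => intro x g; simp [ha x g]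

theorem perm_le_of_ind_one_mem {A : AddSubgroup (G → ℂ)}
    (h : ∀ L : Subgroup G, ind L.subtype 1 ∈ A) : perm G ≤ A := by
  refine (AddSubgroup.closure_le _).2 ?_
  rintro _ ⟨X, _, _, rfl⟩
  have key : fixChar G X = ∑ ω : MulAction.orbitRel.Quotient G X,
      fixChar G (G ⧸ MulAction.stabilizer G ω.out) := by
    ext g
    rw [Finset.sum_apply, fixChar, ← (MulAction.selfEquivSigmaOrbits G X).symm.sum_comp,
      Fintype.sum_sigma]
    refine Finset.sum_congr rfl fun ω _ => ?_
    rw [fixChar, ← (MulAction.orbitEquivQuotientStabilizer G ω.out).symm.sum_comp]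
    refine Finset.sum_congr rfl fun q _ => ?_
    obtain ⟨x, rfl⟩ := QuotientGroup.mk_surjective q
    have e : (MulAction.selfEquivSigmaOrbits G X).symm ⟨ω,
        (MulAction.orbitEquivQuotientStabilizer G ω.out).symm
          (x : G ⧸ MulAction.stabilizer G ω.out)⟩ = x • ω.out := rfl
    have : g • (x : G ⧸ MulAction.stabilizer G ω.out) = x ↔ g • x • ω.out = x • ω.out := by
      change ((g * x : G) : G ⧸ MulAction.stabilizer G ω.out) = x ↔ _
      rw [eq_comm, QuotientGroup.eq, MulAction.mem_stabilizer_iff, mul_smul, inv_smul_eq_iff,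
        mul_smul]
    rw [e]
    simp only [this]
  rw [key]
  exact sum_mem fun ω _ => by rw [fixChar_quotient]; exact h _

theorem perm_le_mono : perm G ≤ mono G :=
  perm_le_of_ind_one_mem fun L => ind_mem_mono (φ := L.subtype) Subtype.coe_injective 1

/-- The functions congruent modulo `PP G` to the sum of a sign character and a constant. -/
def T (G : Type) [Group G] [Fintype G] : AddSubgroup (G → ℂ) where
  carrier := {f | ∃ (ε : G →* ℤˣ) (k : ℤ), f - sgn ε - k • 1 ∈ PP G}
  zero_mem' := ⟨1, -1, by simp⟩
  add_mem' := by
    rintro a b ⟨ε, k, h⟩ ⟨η, l, h'⟩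
    refine ⟨ε * η, k + l + 1, ?_⟩
    convert add_mem (add_mem h h') (quad_mem_PP ε η) using 1
    rw [add_smul, add_smul, one_smul]
    abel
  neg_mem' := by
    rintro a ⟨ε, k, h⟩
    refine ⟨ε, -k - 2, ?_⟩
    have h2 : 2 • (sgn ε - 1) ∈ PP G := two_mem_PP
      (sub_mem (sgn_mem_mono _) one_mem_mono) (by simp)
      (by rw [sub_eq_add_neg, conjFun_add, conjFun_neg, conjFun_sgn, conjFun_one])
    convert sub_mem (neg_mem h) h2 using 1
    rw [sub_smul, neg_smul, smul_sub, two_smul, two_smul, two_smul]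
    abel

theorem PP_le_T : PP G ≤ T G := fun f hf => ⟨1, -1, by simpa using hf⟩

theorem sgn_mem_T (ε : G →* ℤˣ) : sgn ε ∈ T G := ⟨ε, 0, by simp [zero_mem]⟩

theorem one_mem_T : (1 : G → ℂ) ∈ T G := by simpa using sgn_mem_T (1 : G →* ℤˣ)

/-- Generalised permutation characters of degree zero for which every group element has an
even multiplicity of the eigenvalue `-1`. -/
structure IsEvenPerm (f : G → ℂ) : Prop where
  mem : f ∈ perm G
  apply_one : f 1 = 0
  even : ∀ g, ∃ n : ℤ, mult (-1) g f = 2 * n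

theorem mem_PP_of_mem_T {f : G → ℂ} (hf : f ∈ T G) (hS : IsEvenPerm f) : f ∈ PP G := by
  obtain ⟨ε, k, h⟩ := hf
  have h1 := apply_one_of_mem_PP h
  have hk : k = -1 := by
    simp [hS.apply_one] at h1
    have : (k : ℂ) = -1 := by linear_combination -h1
    exact_mod_cast this
  have hε : ε = 1 := by
    ext g
    have hu : (-1 : ℂ) ^ 2 = 1 := by norm_num
    obtain ⟨n, hn⟩ := (PP_le_multsIn h).2 g (-1) hu
    obtain ⟨m, hm⟩ := hS.even g
    rw [map_sub, map_sub, map_zsmul, sgn_eq, mult_monoidHom hu, mult_one hu, hm] at hn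
    rcases Int.units_eq_one_or (ε g) with e | e
    · rw [e]; rfl
    · exfalso
      have : sgnHom ε g = -1 := by simp [sgnHom, e]
      rw [this] at hn
      norm_num at hn
      have : (2 * m - 1 : ℤ) = 2 * n := by exact_mod_cast hn
      omega
  subst hk hε
  simpa using h

theorem IsEvenPerm.comp (φ : H →* G) (hφ : Function.Injective φ) {f : G → ℂ}
    (hf : IsEvenPerm f) : IsEvenPerm (fun h => f (φ h)) where
  mem := comp_mem_perm φ hf.mem
  apply_one := by rw [map_one, hf.apply_one]
  even g := by
    have h := hf.even (φ g)
    simp only [mult_apply, orderOf_injective φ hφ, map_pow] at h ⊢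
    exact h

theorem exists_hom_extending {L : Subgroup G} (hL : L.index = 2) {t : G} (ht : t ∉ L)
    {D : Type} [Group D] (d : L →* D) (s : D)
    (hs : ∀ h : t * t ∈ L, d ⟨t * t, h⟩ = s * s)
    (hc : ∀ (k : G) (hk : k ∈ L) (h : t⁻¹ * k * t ∈ L), s * d ⟨t⁻¹ * k * t, h⟩ = d ⟨k, hk⟩ * s) :
    ∃ e : G →* D, (∀ k : L, e k = d k) ∧ e t = s := by
  have hmem : ∀ {a b : G}, a * b ∈ L ↔ (a ∈ L ↔ b ∈ L) := Subgroup.mul_mem_iff_of_index_two hL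
  have hinv : ∀ {a : G}, a⁻¹ ∈ L ↔ a ∈ L := inv_mem_iff
  set δ : G → D := fun g => if h : g ∈ L then d ⟨g, h⟩ else 1 with hδ
  have hδ1 : ∀ k : L, δ k = d k := fun k => dif_pos k.2
  have hδ2 : ∀ a ∈ L, ∀ b ∈ L, δ (a * b) = δ a * δ b := by
    intro a ha b hb
    have := d.map_mul ⟨a, ha⟩ ⟨b, hb⟩
    simpa [hδ, ha, hb, mul_mem ha hb] using this
  have hδs : δ (t * t) = s * s := by
    have h : t * t ∈ L := by simp [hmem]
    rw [← hs h, ← hδ1]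
  have hδc : ∀ k ∈ L, s * δ (t⁻¹ * k * t) = δ k * s := by
    intro k hk
    have h : t⁻¹ * k * t ∈ L := by simp [hmem, hinv, hk]
    have := hc k hk h
    rwa [← hδ1, ← hδ1] at this
  refine ⟨MonoidHom.mk' (fun g => if g ∈ L then δ g else s * δ (t⁻¹ * g)) ?_, ?_, ?_⟩
  · intro a b
    by_cases ha : a ∈ L <;> by_cases hb : b ∈ L
    · simp [hmem, ha, hb, hδ2 a ha b hb]
    · have h1 : t⁻¹ * b ∈ L := by simp [hmem, hinv, ht, hb]
      have h2 : t⁻¹ * a * t ∈ L := by simp [hmem, hinv, ha]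
      have h3 : t⁻¹ * (a * b) = (t⁻¹ * a * t) * (t⁻¹ * b) := by group
      simp only [hmem, ha, hb, if_pos, if_false, iff_false, not_true]
      rw [h3, hδ2 _ h2 _ h1, ← mul_assoc, hδc a ha, mul_assoc]
    · have h1 : t⁻¹ * a ∈ L := by simp [hmem, hinv, ht, ha]
      simp only [hmem, ha, hb, if_pos, if_false, iff_true]
      rw [← mul_assoc, hδ2 _ h1 _ hb, mul_assoc]
    · have h1 : t⁻¹ * a ∈ L := by simp [hmem, hinv, ht, ha]
      have h2 : t⁻¹ * b ∈ L := by simp [hmem, hinv, ht, hb]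
      have h3 : t⁻¹ * (t⁻¹ * a) * t ∈ L := by simp [hmem, hinv, ht, ha]
      have h4 : a * b = (t * t) * ((t⁻¹ * (t⁻¹ * a) * t) * (t⁻¹ * b)) := by group
      have h5 : t * t ∈ L := by simp [hmem]
      simp only [hmem, ha, hb, if_pos, if_false]
      rw [h4, hδ2 _ h5 _ (mul_mem h3 h2), hδ2 _ h3 _ h2, hδs]
      simp only [mul_assoc]
      rw [← mul_assoc s (δ _), ← mul_assoc t⁻¹, ← mul_assoc (t⁻¹ * t⁻¹),
        mul_assoc t⁻¹ t⁻¹, hδc _ h1, mul_assoc]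
  · intro k
    simp [hδ1]
  · have : δ 1 = 1 := by simpa using hδ1 1
    simp [ht, this]

theorem ind_index_two {L : Subgroup G} (hL : L.index = 2) {t : G} (ht : t ∉ L)
    {f : L → ℂ} (hf : IsClassFun f) (E : G → ℂ) (hE : ∀ k : L, E k = f k)
    (hE0 : ∀ g, g ∉ L → E g = 0) (g : G) :
    ind L.subtype f g = E g + E (t⁻¹ * g * t) := by
  have hmem : ∀ {a b : G}, a * b ∈ L ↔ (a ∈ L ↔ b ∈ L) := Subgroup.mul_mem_iff_of_index_two hL
  have hinv : ∀ {a : G}, a⁻¹ ∈ L ↔ a ∈ L := inv_mem_iff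
  have hinner : ∀ y : G, (∑ k : L, if L.subtype k = y then f k else 0) = E y := by
    intro y
    by_cases hy : y ∈ L
    · rw [Finset.sum_eq_single ⟨y, hy⟩]
      · simp [hE ⟨y, hy⟩]
      · exact fun k _ hk => if_neg fun e => hk (Subtype.ext e)
      · simp
    · rw [hE0 y hy, Finset.sum_eq_zero]
      exact fun k _ => if_neg fun e => hy (by rw [← e]; exact k.2)
  have hEc : ∀ x ∈ L, ∀ y, E (x⁻¹ * y * x) = E y := by
    intro x hx y
    by_cases hy : y ∈ L
    · have := hf ⟨x, hx⟩ ⟨y, hy⟩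
      rw [← hE, ← hE] at this
      exact this
    · rw [hE0 y hy, hE0]
      simp [hmem, hinv, hx, hy]
  have hval : ∀ x, E (x⁻¹ * g * x) = if x ∈ L then E g else E (t⁻¹ * g * t) := by
    intro x
    split_ifs with hx
    · exact hEc x hx g
    · have h : t⁻¹ * x ∈ L := by simp [hmem, hinv, ht, hx]
      rw [← hEc _ h (t⁻¹ * g * t)]
      congr 1
      group
  have hcard : Fintype.card G = Fintype.card L * 2 := by
    rw [← hL, ← Nat.card_eq_fintype_card, ← Nat.card_eq_fintype_card, L.card_mul_index]
  have h1 : (Finset.univ.filter fun x => x ∈ L).card = Fintype.card L := by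
    rw [Fintype.card_subtype]
  have h2 : (Finset.univ.filter fun x => x ∉ L).card = Fintype.card L := by
    have := Finset.card_filter_add_card_filter_not (s := (Finset.univ : Finset G)) (fun x => x ∈ L)
    rw [h1, Finset.card_univ, hcard] at this
    omega
  rw [ind_apply]
  simp_rw [hinner]
  rw [Finset.sum_congr rfl fun x _ => hval x, Finset.sum_ite, Finset.sum_const, Finset.sum_const,
    h1, h2, nsmul_eq_mul, nsmul_eq_mul, ← mul_add, inv_mul_cancel_left₀ card_ne_zero]

/-- The determinant of the standard representation of the dihedral group. -/
def dihDet (n : ℕ) : DihedralGroup n →* ℤˣ :=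
  MonoidHom.mk' (fun | DihedralGroup.r _ => 1 | DihedralGroup.sr _ => -1) (by
    rintro (i | i) (j | j) <;> rfl)

@[simp] theorem dihDet_r {n : ℕ} (i : ZMod n) : dihDet n (.r i) = 1 := rfl

@[simp] theorem dihDet_sr {n : ℕ} (i : ZMod n) : dihDet n (.sr i) = -1 := rfl

/-- An isomorphism of the Klein four-group with a subgroup of the dihedral group of order `8`. -/
def kleinToDihedral : ℤˣ × ℤˣ →* DihedralGroup 4 :=
  MonoidHom.mk' (fun x => if x.1 = 1 then (if x.2 = 1 then DihedralGroup.r 0 else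
    DihedralGroup.sr 0) else (if x.2 = 1 then DihedralGroup.sr 2 else DihedralGroup.r 2))
    (by decide)

theorem klein_formula :
    (∀ a b : ℤˣ, ((a : ℤ) : ℂ) + ((b : ℤ) : ℂ) =
      dih (AddChar.zmodChar 4 (show Complex.I ^ 4 = 1 by simp)) (kleinToDihedral (a, b)) + 1 +
        ((dihDet 4 (kleinToDihedral (a, b)) : ℤ) : ℂ)) ∧
    ∀ s : DihedralGroup 4, (s = .sr 1 ∨ s = .r 1) → ∀ a b : ℤˣ,
      0 = dih (AddChar.zmodChar 4 (show Complex.I ^ 4 = 1 by simp)) (s * kleinToDihedral (a, b)) +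
        1 + ((dihDet 4 (s * kleinToDihedral (a, b)) : ℤ) : ℂ) := by
  set ψ := AddChar.zmodChar 4 (show Complex.I ^ 4 = 1 by simp)
  have hψ1 : ψ 1 = Complex.I := pow_one _
  have hψ2 : ψ 2 = -1 := Complex.I_sq
  have hψ3 : ψ 3 = -Complex.I := Complex.I_pow_three
  have d0 : dih ψ (.r 0) + 1 + ((dihDet 4 (.r 0) : ℤ) : ℂ) = 2 := by
    simp only [dih, dihDet_r]; simp; norm_num
  have d1 : dih ψ (.r 1) + 1 + ((dihDet 4 (.r 1) : ℤ) : ℂ) = 0 := by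
    have : (-1 : ZMod 4) = 3 := rfl
    simp [dih, this, hψ1, hψ3]; norm_num
  have d2 : dih ψ (.r 2) + 1 + ((dihDet 4 (.r 2) : ℤ) : ℂ) = -2 := by
    have : (-2 : ZMod 4) = 2 := rfl
    simp [dih, this, hψ2]; norm_num
  have d3 : dih ψ (.r 3) + 1 + ((dihDet 4 (.r 3) : ℤ) : ℂ) = 0 := by
    have : (-3 : ZMod 4) = 1 := rfl
    simp [dih, this, hψ1, hψ3]; norm_num
  have ds : ∀ i, dih ψ (.sr i) + 1 + ((dihDet 4 (.sr i) : ℤ) : ℂ) = 0 := by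
    intro i
    simp [dih]
  constructor
  · intro a b
    rcases Int.units_eq_one_or a with rfl | rfl <;> rcases Int.units_eq_one_or b with rfl | rfl
    · rw [show kleinToDihedral (1, 1) = .r 0 by decide, d0]; norm_num
    · rw [show kleinToDihedral (1, -1) = .sr 0 by decide, ds]; norm_num
    · rw [show kleinToDihedral (-1, 1) = .sr 2 by decide, ds]; norm_num
    · rw [show kleinToDihedral (-1, -1) = .r 2 by decide, d2]; norm_num
  · intro s hs a b
    have h : ∀ s : DihedralGroup 4, (s = .sr 1 ∨ s = .r 1) → ∀ a b : ℤˣ,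
      (s * kleinToDihedral (a, b) = .r 1 ∨ s * kleinToDihedral (a, b) = .r 3) ∨
        (∃ i, s * kleinToDihedral (a, b) = .sr i) := by decide
    rcases h s hs a b with (h | h) | ⟨i, h⟩
    · rw [h, d1]
    · rw [h, d3]
    · rw [h, ds]

theorem ind_sgn_mem_T_of_index_two {L : Subgroup G} (hL : L.index = 2) (ε : L →* ℤˣ) :
    ind L.subtype (sgn ε) ∈ T G := by
  have hmem : ∀ {a b : G}, a * b ∈ L ↔ (a ∈ L ↔ b ∈ L) := Subgroup.mul_mem_iff_of_index_two hL
  have hinv : ∀ {a : G}, a⁻¹ ∈ L ↔ a ∈ L := inv_mem_iff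
  obtain ⟨t, ht⟩ : ∃ t, t ∉ L := by
    by_contra! h
    have : L = ⊤ := (Subgroup.eq_top_iff' L).2 h
    rw [this] at hL
    simp at hL
  have htc : ∀ k ∈ L, t⁻¹ * k * t ∈ L := fun k hk => by simp [hmem, hinv, hk]
  have htt : t * t ∈ L := by simp [hmem]
  have hcl : IsClassFun (sgn ε) := isClassFun_monoidHom (sgnHom ε)
  set E : G → ℂ := fun g => if h : g ∈ L then sgn ε ⟨g, h⟩ else 0 with hE
  have hind := ind_index_two hL ht hcl E (fun k => dif_pos k.2) (fun g hg => dif_neg hg)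
  have hind0 : ∀ k : L, ind L.subtype (sgn ε) (t * k) = 0 := by
    intro k
    rw [hind]
    simp [hE, hmem, ht]
  have hind1 : ∀ k : L, ind L.subtype (sgn ε) k =
      sgn ε k + sgn ε ⟨t⁻¹ * k * t, htc k k.2⟩ := by
    intro k
    rw [hind]
    simp only [hE]
    rw [dif_pos k.2, dif_pos (htc k k.2)]
  have hext : ∀ F : G → ℂ, (∀ k : L, ind L.subtype (sgn ε) k = F k) →
      (∀ k : L, 0 = F (t * k)) → ind L.subtype (sgn ε) = F := by
    intro F h1 h2
    ext g
    by_cases hg : g ∈ L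
    · exact h1 ⟨g, hg⟩
    · have h : t⁻¹ * g ∈ L := by simp [hmem, hinv, ht, hg]
      have := hind0 ⟨_, h⟩
      have h3 := h2 ⟨_, h⟩
      simp only [mul_inv_cancel_left] at this h3
      rw [this, h3]
  by_cases hinvt : ∀ (k : G) (hk : k ∈ L), ε ⟨t⁻¹ * k * t, htc k hk⟩ = ε ⟨k, hk⟩
  · rcases Int.units_eq_one_or (ε ⟨t * t, htt⟩) with h1 | h1
    · obtain ⟨χ₁, hχ₁, hχ₁t⟩ := exists_hom_extending hL ht ε 1 (fun _ => by rw [h1]; rfl)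
        (fun k hk h => by rw [hinvt k hk, mul_comm])
      obtain ⟨χ₂, hχ₂, hχ₂t⟩ := exists_hom_extending hL ht ε (-1) (fun _ => by rw [h1]; rfl)
        (fun k hk h => by rw [hinvt k hk, mul_comm])
      rw [hext (sgn χ₁ + sgn χ₂)]
      · exact add_mem (sgn_mem_T _) (sgn_mem_T _)
      · intro k
        rw [hind1]
        simp [sgn, hχ₁, hχ₂, hinvt]
      · intro k
        simp [sgn, hχ₁t, hχ₂t, hχ₁, hχ₂]
    · set d : L →* ℂˣ := (Units.map (Int.castRingHom ℂ : ℤ →* ℂ)).comp ε with hd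
      obtain ⟨χ, hχ, hχt⟩ := exists_hom_extending hL ht d (Units.mk0 Complex.I Complex.I_ne_zero)
        (fun _ => Units.ext (by simp [hd, h1])) (fun k hk h => by
          rw [mul_comm, hd, MonoidHom.comp_apply, hinvt k hk, MonoidHom.comp_apply])
      set τ : G → ℂ := ⇑((Units.coeHom ℂ).comp χ) with hτ
      have hτm : τ ∈ mono G := monoidHom_mem_mono ((Units.coeHom ℂ).comp χ)
      rw [hext (((τ - 1) + conjFun (τ - 1)) + 1 + 1)]
      · refine add_mem (add_mem (PP_le_T (conj_mem_PP (sub_mem hτm one_mem_mono) ?_)) one_mem_T)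
          one_mem_T
        simp [hτ]
      · intro k
        rw [hind1]
        simp [sgn, hτ, hχ, hinvt, conjFun, hd]
        ring
      · intro k
        simp [hτ, hχ, hχt, conjFun, hd]
        ring
  · set ε' : L →* ℤˣ := MonoidHom.mk' (fun k => ε ⟨t⁻¹ * k * t, htc k k.2⟩) (by
      intro a b
      rw [← map_mul]
      congr 1
      ext
      simp [mul_assoc]) with hε'
    have hε'' : ∀ (k : G) (hk : k ∈ L), ε' ⟨t⁻¹ * k * t, htc k hk⟩ = ε ⟨k, hk⟩ := by
      intro k hk
      have : (⟨t⁻¹ * (t⁻¹ * k * t) * t, htc _ (htc k hk)⟩ : L) =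
          (⟨t * t, htt⟩ : L)⁻¹ * ⟨k, hk⟩ * ⟨t * t, htt⟩ := by
        ext
        simp [mul_assoc]
      simp only [hε', MonoidHom.mk'_apply]
      rw [this, map_mul, map_mul, mul_right_comm, ← map_mul]
      simp
    have hε't : ε' ⟨t * t, htt⟩ = ε ⟨t * t, htt⟩ := by
      simp only [hε', MonoidHom.mk'_apply]
      congr 2
      group
    set d := kleinToDihedral.comp (ε.prod ε') with hd
    obtain ⟨s, hs, hs1⟩ : ∃ s : DihedralGroup 4, (s = .sr 1 ∨ s = .r 1) ∧
        d ⟨t * t, htt⟩ = s * s := by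
      simp only [hd, MonoidHom.comp_apply, MonoidHom.prod_apply, hε't]
      rcases Int.units_eq_one_or (ε ⟨t * t, htt⟩) with h1 | h1
      · exact ⟨.sr 1, Or.inl rfl, by rw [h1]; decide⟩
      · exact ⟨.r 1, Or.inr rfl, by rw [h1]; decide⟩
    have hs2 : ∀ a b : ℤˣ, s * kleinToDihedral (b, a) = kleinToDihedral (a, b) * s := by
      rcases hs with rfl | rfl <;> decide
    obtain ⟨e, he, het⟩ := exists_hom_extending hL ht d s (fun _ => hs1) (fun k hk h => by
      simp only [hd, MonoidHom.comp_apply, MonoidHom.prod_apply, hε'' k hk]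
      exact hs2 _ _)
    have hsurj : Function.Surjective e := by
      push Not at hinvt
      obtain ⟨k, hk, hne⟩ := hinvt
      have h1 : ∀ a b : ℤˣ, b ≠ a → (kleinToDihedral (a, b) = .sr 0 ∨
        kleinToDihedral (a, b) = .sr 2) := by decide
      have h2 := h1 _ _ hne
      have h3 : e k = kleinToDihedral (ε ⟨k, hk⟩, ε ⟨t⁻¹ * k * t, htc k hk⟩) := he ⟨k, hk⟩
      rw [← h3] at h2
      rw [← het] at hs
      intro z
      have h4 : ∀ s x z : DihedralGroup 4, (s = .sr 1 ∨ s = .r 1) → (x = .sr 0 ∨ x = .sr 2) →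
          ∃ (i : Fin 4) (j : Fin 2), z = (s * x) ^ (i : ℕ) * x ^ (j : ℕ) ∨
            z = s ^ (i : ℕ) * x ^ (j : ℕ) := by decide
      obtain ⟨i, j, h5 | h5⟩ := h4 (e t) (e k) z hs h2
      · exact ⟨(t * k) ^ (i : ℕ) * k ^ (j : ℕ), by rw [h5]; simp⟩
      · exact ⟨t ^ (i : ℕ) * k ^ (j : ℕ), by rw [h5]; simp⟩
    have hI : Complex.I ^ 4 = 1 := by simp
    set ψ : AddChar (ZMod 4) ℂ := AddChar.zmodChar 4 hI with hψ
    rw [hext ((fun g => dih ψ (e g)) + 1 + sgn ((dihDet 4).comp e))]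
    · exact add_mem (add_mem (PP_le_T (dih_mem_PP (Or.inl rfl) e hsurj ψ)) one_mem_T)
        (sgn_mem_T _)
    · intro k
      rw [hind1]
      have h := he k
      simp only [hd, MonoidHom.comp_apply, MonoidHom.prod_apply] at h
      simp only [Pi.add_apply, Pi.one_apply, sgn, MonoidHom.comp_apply, h]
      exact klein_formula.1 _ _
    · intro k
      have h := he k
      simp only [hd, MonoidHom.comp_apply, MonoidHom.prod_apply] at h
      simp only [Pi.add_apply, Pi.one_apply, sgn, MonoidHom.comp_apply, map_mul, h, het]
      rw [← map_mul]
      exact klein_formula.2 s hs _ _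

theorem ind_mem_T_of_index_two {L : Subgroup G} (hL : L.index = 2) {f : L → ℂ} (hf : f ∈ T L) :
    ind L.subtype f ∈ T G := by
  obtain ⟨ε, k, h⟩ := hf
  have h1 := PP_le_T (ind_mem_PP (φ := L.subtype) Subtype.coe_injective h)
  rw [map_sub, map_sub, map_zsmul, ← sgn_one] at h1
  have h2 := add_mem (add_mem h1 ((T G).zsmul_mem (ind_sgn_mem_T_of_index_two hL 1) k))
    (ind_sgn_mem_T_of_index_two hL ε)
  simpa using h2

theorem fixChar_eq_ind_stabilizer (X : Type) [MulAction G X] [Fintype X] (x₀ : X)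
    (h : ∀ x, ∃ g : G, g • x₀ = x) {L : Subgroup G} (hL : MulAction.stabilizer G x₀ = L) :
    fixChar G X = ind L.subtype 1 := by
  subst hL
  rw [← fixChar_quotient]
  ext g
  have hb : Function.Bijective (MulAction.ofQuotientStabilizer G x₀) :=
    ⟨MulAction.injective_ofQuotientStabilizer G x₀, fun x => by
      obtain ⟨g, rfl⟩ := h x
      exact ⟨g, rfl⟩⟩
  rw [fixChar, fixChar, ← (Equiv.ofBijective _ hb).sum_comp]
  refine Finset.sum_congr rfl fun q _ => ?_
  rw [Equiv.ofBijective_apply, ← MulAction.ofQuotientStabilizer_smul, hb.1.eq_iff]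

theorem ind_one_eq_of_range_eq {φ : H →* G} (hφ : Function.Injective φ) {ψ : K →* G}
    (hψ : Function.Injective ψ) (h : φ.range = ψ.range) : ind φ 1 = ind ψ 1 := by
  rw [ind_eq_indChar hφ, ind_eq_indChar hψ]
  change indChar φ.range 1 = indChar ψ.range 1
  rw [h]

theorem index_ker_of_ne_one {ε : G →* ℤˣ} {t : G} (ht : ε t ≠ 1) : ε.ker.index = 2 := by
  have h : ε t = -1 := (Int.units_eq_one_or _).resolve_left ht
  rw [Subgroup.index_ker, MonoidHom.range_eq_top.2, Subgroup.card_top]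
  · simp
  · intro u
    rcases Int.units_eq_one_or u with rfl | rfl
    · exact ⟨1, map_one ε⟩
    · exact ⟨t, h⟩

theorem one_add_sgn {ε : G →* ℤˣ} (hε : ε ≠ 1) : 1 + sgn ε = ind ε.ker.subtype 1 := by
  obtain ⟨t, ht⟩ := DFunLike.ne_iff.1 hε
  ext g
  have h : ind ε.ker.subtype 1 g =
      (if ε g = 1 then 1 else 0) + if ε (t⁻¹ * g * t) = 1 then 1 else 0 := by
    convert ind_index_two (f := 1) (index_ker_of_ne_one ht) (t := t) (by simpa using ht)
      (fun _ _ => rfl) (fun g => if ε g = 1 then 1 else 0) (fun k => if_pos k.2)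
      (fun g hg => if_neg hg) g
  rw [h]
  rcases Int.units_eq_one_or (ε g) with h | h
  · simp [sgn, h]
  · simp [sgn, h]

section Affine

variable {q : ℕ} [Fact q.Prime] {α : G →* (ZMod q)ˣ} {β : G → ZMod q}

/-- The action on `ZMod q` by affine maps with linear part `α` and translation part `β`. -/
abbrev affineAction (hβ : ∀ g h, β (g * h) = β g + α g * β h) : MulAction G (ZMod q) where
  smul g x := α g * x + β g
  one_smul x := by
    change ((α 1 : (ZMod q)ˣ) : ZMod q) * x + β 1 = x
    have := hβ 1 1
    simp at this
    simp [this]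
  mul_smul g h x := by
    change ((α (g * h) : (ZMod q)ˣ) : ZMod q) * x + β (g * h) = α g * (α h * x + β h) + β g
    rw [hβ, map_mul, Units.val_mul]
    ring

theorem ind_one_apply_of_affine (hβ : ∀ g h, β (g * h) = β g + α g * β h) {c : G}
    (hc : α c = 1) (hc' : β c = 1) {L : Subgroup G} (hL : ∀ g, g ∈ L ↔ β g = 0) (g : G) :
    ind L.subtype 1 g = if α g = 1 then (if β g = 0 then (q : ℂ) else 0) else 1 := by
  let _ := affineAction hβ
  have hsmul : ∀ (g : G) (x : ZMod q), g • x = α g * x + β g := fun _ _ => rfl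
  have hst : MulAction.stabilizer G (0 : ZMod q) = L := by
    ext g
    rw [MulAction.mem_stabilizer_iff, hsmul, hL]
    simp
  have hβ1 : β 1 = 0 := by simpa using hβ 1 1
  have hpow : ∀ k : ℕ, β (c ^ k) = k := by
    intro k
    induction k with
    | zero => simp [hβ1]
    | succ k ih => rw [pow_succ, hβ, map_pow, hc, ih, hc']; simp
  rw [← fixChar_eq_ind_stabilizer (ZMod q) 0 ?_ hst, fixChar]
  · simp only [hsmul]
    split_ifs with h1 h2
    · simp [h1, h2]
    · simp [h1, h2]
    · have h3 : (1 - α g : ZMod q) ≠ 0 := fun h => h1 (Units.ext (sub_eq_zero.1 h).symm)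
      rw [Finset.sum_eq_single (β g / (1 - α g))]
      · rw [if_pos]
        field_simp
        ring
      · intro x _ hx
        refine if_neg fun h => hx ?_
        rw [eq_div_iff h3]
        linear_combination -h
      · simp
  · intro x
    refine ⟨c ^ x.val, ?_⟩
    rw [hsmul, hpow]
    simp

variable (α) in
/-- The product of the linear part of an affine action with the sign. -/
def signedLinear : G × ℤˣ →* (ZMod q)ˣ :=
  MonoidHom.coprod α (Units.map (Int.castRingHom (ZMod q) : ℤ →* ZMod q))

theorem signedLinear_one (g : G) : signedLinear α (g, 1) = α g := by simp [signedLinear]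

theorem signedLinear_neg_one (g : G) : signedLinear α (g, -1) = -α g := by
  ext
  simp [signedLinear]

variable (α) in
/-- The elements acting on `ZMod q` with linear part `±1`, together with that sign. -/
abbrev Signed : Subgroup (G × ℤˣ) := (signedLinear α).ker

variable (α) in
/-- The projection of `Signed α` to `G`. -/
def signedFst : Signed α →* G := (MonoidHom.fst G ℤˣ).comp (Signed α).subtype

variable (α) in
/-- The sign of an element of `Signed α`. -/
def signedSnd : Signed α →* ℤˣ := (MonoidHom.snd G ℤˣ).comp (Signed α).subtype

theorem alpha_signedFst (m : Signed α) :
    (α (signedFst α m) : ZMod q) = ((signedSnd α m : ℤ) : ZMod q) := by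
  rcases m with ⟨⟨g, ε⟩, hm⟩
  rw [MonoidHom.mem_ker] at hm
  change (α g : ZMod q) = ((ε : ℤ) : ZMod q)
  rcases Int.units_eq_one_or ε with rfl | rfl
  · rw [signedLinear_one] at hm
    simp [hm]
  · rw [signedLinear_neg_one, neg_eq_iff_eq_neg] at hm
    simp [hm]

theorem neg_one_ne_one_of_odd (hq : Odd q) : (-1 : (ZMod q)ˣ) ≠ 1 := by
  intro h
  have h1 : (-1 : ZMod q) = 1 := by simpa using congrArg Units.val h
  have : Fact (2 < q) :=
    ⟨lt_of_le_of_ne (Fact.out : q.Prime).two_le (by rintro rfl; revert hq; decide)⟩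
  exact ZMod.neg_one_ne_one h1

theorem alpha_signedFst_eq_one (hq : Odd q) (m : Signed α) :
    α (signedFst α m) = 1 ↔ signedSnd α m = 1 := by
  have h := alpha_signedFst m
  rcases Int.units_eq_one_or (signedSnd α m) with e | e
  · rw [e] at h
    simp at h
    simp [h, e]
  · rw [e] at h
    have h1 : α (signedFst α m) = -1 := by ext; simp [h]
    rw [h1, e]
    simp [neg_one_ne_one_of_odd hq]

theorem signedFst_injective (hq : Odd q) : Function.Injective (signedFst α) := by
  rw [injective_iff_map_eq_one]
  intro m hm
  have h2 : signedSnd α m = 1 := by rw [← alpha_signedFst_eq_one hq, hm, map_one]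
  exact Subtype.ext (Prod.ext hm h2)

/-- The character of `Signed α` whose induction is a constituent of the affine permutation
character. -/
def signedChar (α : G →* (ZMod q)ˣ) (β : G → ZMod q) (ψ : AddChar (ZMod q) ℂ) (x : (ZMod q)ˣ) :
    Signed α → ℂ :=
  fun m => if signedSnd α m = 1 then
    ψ (x * β (signedFst α m)) + ψ (-(x * β (signedFst α m))) else 0

theorem beta_conj (hβ : ∀ g h, β (g * h) = β g + α g * β h) {g : G} (hg : α g = 1) (u : G) :
    β (u * g * u⁻¹) = α u * β g := by
  have h1 : β 1 = 0 := by simpa using hβ 1 1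
  have h := hβ u u⁻¹
  rw [mul_inv_cancel, h1] at h
  rw [hβ, hβ, map_mul, hg, mul_one]
  linear_combination -h

theorem ind_signedChar_apply (hq : Odd q) (hβ : ∀ g h, β (g * h) = β g + α g * β h)
    (ψ : AddChar (ZMod q) ℂ) (x : (ZMod q)ˣ) (g : G) :
    ind (signedFst α) (signedChar α β ψ x) g = if α g = 1 then
      (Fintype.card (Signed α) : ℂ)⁻¹ *
        ∑ a : G × ℤˣ, ψ (((x * signedLinear α a : (ZMod q)ˣ) : ZMod q) * β g) else 0 := by
  have hconj : ∀ u, α (u * g * u⁻¹) = α g := fun u => by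
    rw [map_mul, map_mul, map_inv, mul_comm, inv_mul_cancel_left]
  rw [ind_apply, ← Equiv.sum_comp (Equiv.inv G)]
  simp only [Equiv.inv_apply, inv_inv]
  split_ifs with hg
  · rw [Fintype.sum_prod_type]
    congr 1
    refine Finset.sum_congr rfl fun u _ => ?_
    have hmem : (u * g * u⁻¹, (1 : ℤˣ)) ∈ Signed α := by
      rw [MonoidHom.mem_ker, signedLinear_one, hconj, hg]
    rw [Finset.sum_eq_single ⟨_, hmem⟩]
    · have e1 : signedFst α ⟨_, hmem⟩ = u * g * u⁻¹ := rfl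
      have e2 : signedSnd α ⟨_, hmem⟩ = 1 := rfl
      have e3 : (Finset.univ : Finset ℤˣ) = {1, -1} := rfl
      rw [if_pos e1, signedChar, if_pos e2, e1, beta_conj hβ hg, e3,
        Finset.sum_pair (by decide), signedLinear_one, signedLinear_neg_one]
      simp [mul_assoc]
    · intro m _ hm
      refine if_neg fun h => hm (Subtype.ext (Prod.ext h ?_))
      exact (alpha_signedFst_eq_one hq m).1 (by
        rw [show signedFst α m = u * g * u⁻¹ from h, hconj, hg])
    · simp
  · rw [Finset.sum_eq_zero, mul_zero]
    intro u _
    refine Finset.sum_eq_zero fun m _ => ?_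
    split_ifs with h
    · rw [signedChar, if_neg]
      rwa [← alpha_signedFst_eq_one hq, h, hconj]
    · rfl

theorem ind_one_eq_sum_ind_signedChar (hq : Odd q) (hβ : ∀ g h, β (g * h) = β g + α g * β h)
    {c : G} (hc : α c = 1) (hc' : β c = 1) {L : Subgroup G} (hL : ∀ g, g ∈ L ↔ β g = 0)
    {ψ : AddChar (ZMod q) ℂ} (hψ : ψ.IsPrimitive) :
    ind L.subtype 1 = 1 + ∑ y : (ZMod q)ˣ ⧸ (signedLinear α).range,
      ind (signedFst α) (signedChar α β ψ y.out) := by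
  set Γ := (signedLinear α).range
  ext g
  rw [ind_one_apply_of_affine hβ hc hc' hL, Pi.add_apply, Pi.one_apply, Finset.sum_apply]
  simp_rw [ind_signedChar_apply hq hβ]
  by_cases hg : α g = 1
  · simp only [if_pos hg]
    set D : (ZMod q)ˣ → ℂ := fun x => (Fintype.card (Signed α) : ℂ)⁻¹ *
        ∑ a : G × ℤˣ, ψ (((x * signedLinear α a : (ZMod q)ˣ) : ZMod q) * β g) with hD
    have hDΓ : ∀ x, ∀ γ ∈ Γ, D (x * γ) = D x := by
      rintro x _ ⟨b, rfl⟩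
      simp only [hD]
      rw [← Equiv.sum_comp (Equiv.mulLeft b) fun a =>
        ψ (((x * signedLinear α a : (ZMod q)ˣ) : ZMod q) * β g)]
      simp [mul_assoc]
    have hD' : ∀ x : (ZMod q)ˣ, D (x : (ZMod q)ˣ ⧸ Γ).out = D x := by
      intro x
      obtain ⟨l, hl⟩ := QuotientGroup.mk_out_eq_mul Γ x
      rw [hl, hDΓ _ _ l.2]
    have h1 := sum_quotient_mk Γ (fun y : (ZMod q)ˣ ⧸ Γ => D y.out)
    simp_rw [hD'] at h1
    have h2 : ∑ x, D x = Nat.card Γ * ∑ x : (ZMod q)ˣ, ψ (x * β g) := by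
      simp only [hD]
      rw [← Finset.mul_sum, Finset.sum_comm]
      have h4 : ∀ a, (∑ x : (ZMod q)ˣ, ψ (((x * signedLinear α a : (ZMod q)ˣ) : ZMod q) * β g)) =
          ∑ x : (ZMod q)ˣ, ψ (x * β g) := fun a =>
        Equiv.sum_comp (Equiv.mulRight (signedLinear α a))
          (fun x : (ZMod q)ˣ => ψ ((x : ZMod q) * β g))
      have h5 : (Fintype.card (G × ℤˣ) : ℂ) = Fintype.card (Signed α) * Nat.card Γ := by
        have := (Signed α).card_mul_index
        rw [Subgroup.index_ker, Nat.card_eq_fintype_card, Nat.card_eq_fintype_card (α := G × ℤˣ)]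
          at this
        exact_mod_cast this.symm
      simp_rw [h4]
      rw [Finset.sum_const, Finset.card_univ, nsmul_eq_mul, h5, mul_assoc,
        inv_mul_cancel_left₀ card_ne_zero]
    have h3 : (Nat.card Γ : ℂ) ≠ 0 := Nat.cast_ne_zero.2 Nat.card_pos.ne'
    rw [h2] at h1
    rw [← mul_left_cancel₀ h3 h1]
    have h6 := AddChar.sum_mulShift (β g) hψ
    rw [← (Equiv.sumCompl (· = (0 : ZMod q))).sum_comp, Fintype.sum_sum_type,
      ← unitsEquivNeZero.sum_comp] at h6
    simp only [Equiv.sumCompl_apply_inl, Fintype.sum_unique, Equiv.sumCompl_apply_inr,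
      unitsEquivNeZero_apply_coe, ZMod.card] at h6
    rw [show ((default : {x : ZMod q // x = 0}) : ZMod q) = 0 from rfl, zero_mul,
      AddChar.map_zero_eq_one] at h6
    rw [h6]
    push_cast
    rfl
  · simp [hg]

/-- The map from the elements with linear part `±1` to the dihedral group. -/
def signedToDihedral (hβ : ∀ g h, β (g * h) = β g + α g * β h) : Signed α →* DihedralGroup q :=
  MonoidHom.mk' (fun m => if signedSnd α m = 1 then .r (β (signedFst α m)) else
    .sr (-β (signedFst α m))) (by
      intro a b
      rw [map_mul, map_mul, hβ, alpha_signedFst]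
      rcases Int.units_eq_one_or (signedSnd α a) with e₁ | e₁ <;>
        rcases Int.units_eq_one_or (signedSnd α b) with e₂ | e₂ <;>
        simp [e₁, e₂] <;> ring)

theorem ind_signedChar_mem_T (hq : Odd q) (hβ : ∀ g h, β (g * h) = β g + α g * β h)
    {c : G} (hc : α c = 1) (hc' : β c = 1) (hT : ind α.ker.subtype 1 ∈ T G)
    (ψ : AddChar (ZMod q) ℂ) (x : (ZMod q)ˣ) :
    ind (signedFst α) (signedChar α β ψ x) ∈ T G := by
  have hβ1 : β 1 = 0 := by simpa using hβ 1 1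
  have hpow : ∀ k : ℕ, β (c ^ k) = k := by
    intro k
    induction k with
    | zero => simp [hβ1]
    | succ k ih => rw [pow_succ, hβ, map_pow, hc, ih, hc']; simp
  by_cases hneg : ∃ m : Signed α, signedSnd α m = -1
  · obtain ⟨m₀, hm₀⟩ := hneg
    have hsurj : Function.Surjective (signedToDihedral hβ) := by
      have hr : ∀ i, ∃ m, signedToDihedral hβ m = .r i := by
        intro i
        have hmem : (c ^ i.val, (1 : ℤˣ)) ∈ Signed α := by
          rw [MonoidHom.mem_ker, signedLinear_one, map_pow, hc, one_pow]
        refine ⟨⟨_, hmem⟩, ?_⟩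
        have e : signedFst α ⟨_, hmem⟩ = c ^ i.val := rfl
        have e' : signedSnd α ⟨_, hmem⟩ = 1 := rfl
        simp [signedToDihedral, e, e', hpow]
      rintro (i | i)
      · exact hr i
      · obtain ⟨m, hm⟩ := hr (i + β (signedFst α m₀))
        refine ⟨m₀ * m, ?_⟩
        rw [map_mul, hm]
        simp [signedToDihedral, hm₀]
    have heq : signedChar α β ψ x = (fun m => dih (ψ.mulShift x) (signedToDihedral hβ m)) +
        (1 + sgn (signedSnd α)) := by
      ext m
      rcases Int.units_eq_one_or (signedSnd α m) with e | e
      · simp [signedChar, signedToDihedral, dih, sgn, e, AddChar.mulShift_apply]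
        ring
      · simp [signedChar, signedToDihedral, dih, sgn, e]
    have hne : signedSnd α ≠ 1 := DFunLike.ne_iff.2 ⟨m₀, by rw [hm₀, MonoidHom.one_apply]; decide⟩
    have hrange : ((signedFst α).comp (signedSnd α).ker.subtype).range = α.ker.subtype.range := by
      ext g
      constructor
      · rintro ⟨m, rfl⟩
        exact ⟨⟨_, (alpha_signedFst_eq_one hq m.1).2 m.2⟩, rfl⟩
      · rintro ⟨m, rfl⟩
        exact ⟨⟨⟨(m, 1), by rw [MonoidHom.mem_ker, signedLinear_one]; exact m.2⟩, rfl⟩, rfl⟩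
    rw [heq, map_add, one_add_sgn hne, ind_ind, ind_one_eq_of_range_eq
      (φ := (signedFst α).comp (signedSnd α).ker.subtype)
      ((signedFst_injective hq).comp (Subgroup.subtype_injective (signedSnd α).ker))
      α.ker.subtype_injective hrange]
    refine add_mem (PP_le_T (ind_mem_PP (signedFst_injective hq)
      (dih_mem_PP (Or.inr ⟨hq, Fact.out⟩) _ hsurj _))) hT
  · push Not at hneg
    have h1 : ∀ m : Signed α, signedSnd α m = 1 := fun m =>
      (Int.units_eq_one_or _).resolve_right (hneg m)
    set l : Signed α →* ℂ :=
      { toFun := fun m => ψ (x * β (signedFst α m))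
        map_one' := by simp [hβ1]
        map_mul' := fun a b => by
          change ψ (x * β (signedFst α (a * b))) = _
          rw [map_mul (signedFst α), hβ, alpha_signedFst, h1, ← AddChar.map_add_eq_mul]
          simp [mul_add] } with hl
    have heq : signedChar α β ψ x = ((l : Signed α → ℂ) - 1) + conjFun ((l : Signed α → ℂ) - 1) +
        2 • (1 : Signed α → ℂ) := by
      ext m
      simp only [signedChar, h1, if_true, AddChar.map_neg_eq_conj, hl, conjFun, Pi.add_apply,
        Pi.sub_apply, Pi.one_apply, MonoidHom.coe_mk, OneHom.coe_mk, map_sub, map_one,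
        two_nsmul]
      ring
    have hrange : (signedFst α).range = α.ker.subtype.range := by
      ext g
      constructor
      · rintro ⟨m, rfl⟩
        exact ⟨⟨_, (alpha_signedFst_eq_one hq m).2 (h1 m)⟩, rfl⟩
      · rintro ⟨m, rfl⟩
        exact ⟨⟨(m, 1), by rw [MonoidHom.mem_ker, signedLinear_one]; exact m.2⟩, rfl⟩
    rw [heq, map_add, map_nsmul, ind_one_eq_of_range_eq (signedFst_injective hq)
      α.ker.subtype_injective hrange]
    exact add_mem (PP_le_T (ind_mem_PP (signedFst_injective hq) (conj_mem_PP
      (sub_mem (monoidHom_mem_mono l) one_mem_mono) (by simp)))) (nsmul_mem hT 2)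

theorem ind_one_mem_T_of_affine (hq : Odd q) (hβ : ∀ g h, β (g * h) = β g + α g * β h)
    {c : G} (hc : α c = 1) (hc' : β c = 1) (hT : ind α.ker.subtype 1 ∈ T G)
    {L : Subgroup G} (hL : ∀ g, g ∈ L ↔ β g = 0) : ind L.subtype 1 ∈ T G := by
  rw [ind_one_eq_sum_ind_signedChar hq hβ hc hc' hL
    (AddChar.zmodChar_primitive_of_primitive_root q
      (Complex.isPrimitiveRoot_exp q (Fact.out : q.Prime).ne_zero))]
  exact add_mem one_mem_T (sum_mem fun y _ => ind_signedChar_mem_T hq hβ hc hc' hT _ _)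

end Affine

theorem ind_subgroupOf {H K : Subgroup G} (h : H ≤ K) :
    ind K.subtype (ind (H.subgroupOf K).subtype 1) = ind H.subtype 1 := by
  rw [ind_ind, ind_one_eq_of_range_eq (φ := K.subtype.comp (H.subgroupOf K).subtype)
    (K.subtype_injective.comp (H.subgroupOf K).subtype_injective) H.subtype_injective]
  rw [MonoidHom.range_comp, Subgroup.range_subtype, Subgroup.range_subtype,
    Subgroup.map_subgroupOf_eq_of_le h]

theorem ind_map_subtype {K : Subgroup G} (L : Subgroup K) :
    ind K.subtype (ind L.subtype 1) = ind (L.map K.subtype).subtype 1 := by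
  rw [ind_ind, ind_one_eq_of_range_eq (φ := K.subtype.comp L.subtype)
    (K.subtype_injective.comp L.subtype_injective) (L.map K.subtype).subtype_injective]
  rw [MonoidHom.range_comp, Subgroup.range_subtype, Subgroup.range_subtype]

theorem ind_top_one : ind (⊤ : Subgroup G).subtype 1 = 1 := by
  rw [ind_one_eq_of_range_eq (Subgroup.subtype_injective _)
    (ψ := MonoidHom.id G) Function.injective_id (by
      rw [Subgroup.range_subtype, eq_comm, MonoidHom.range_eq_top]
      exact Function.surjective_id), ind_id]
  intro _ _
  rfl

/-- Groups with a cyclic normal subgroup generated by an element `c` of odd order, the quotient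
by which is a `2`-group. -/
structure IsQuasiElementary (c : G) : Prop where
  odd : Odd (orderOf c)
  normal : (Subgroup.zpowers c).Normal
  pow_mem : ∀ g : G, ∃ k : ℕ, g ^ 2 ^ k ∈ Subgroup.zpowers c

theorem IsQuasiElementary.comap {c : G} (hc : IsQuasiElementary c) {φ : H →* G}
    (hφ : Function.Injective φ) : ∃ d : H, IsQuasiElementary d := by
  set D := (Subgroup.zpowers c).comap φ
  have hD : IsCyclic D := isCyclic_of_injective
    ((φ.comp D.subtype).codRestrict (Subgroup.zpowers c) fun d => d.2)
    ((MonoidHom.injective_codRestrict _ _ _).2 (hφ.comp D.subtype_injective))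
  obtain ⟨d, hd⟩ := D.isCyclic_iff_exists_zpowers_eq_top.1 hD
  have := hc.normal
  refine ⟨d, ?_, ?_, fun g => ?_⟩
  · rw [← orderOf_injective φ hφ]
    have hmem : φ d ∈ Subgroup.zpowers c := by
      have : d ∈ D := hd ▸ Subgroup.mem_zpowers d
      exact this
    exact Odd.of_dvd_nat hc.odd (orderOf_dvd_of_mem_zpowers hmem)
  · rw [hd]
    infer_instance
  · obtain ⟨k, hk⟩ := hc.pow_mem (φ g)
    refine ⟨k, ?_⟩
    rw [hd, Subgroup.mem_comap, map_pow]
    exact hk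

theorem IsQuasiElementary.exists_index_two {c : G} (hc : IsQuasiElementary c) {M : Subgroup G}
    (hM : c ∈ M) (hM' : M ≠ ⊤) : ∃ K : Subgroup G, K.index = 2 ∧ M ≤ K := by
  have := hc.normal
  set C := Subgroup.zpowers c
  have hCM : C ≤ M := by rwa [Subgroup.zpowers_le]
  have : Fact (Nat.Prime 2) := ⟨Nat.prime_two⟩
  have hp : IsPGroup 2 (G ⧸ C) := by
    intro x
    obtain ⟨g, rfl⟩ := QuotientGroup.mk_surjective x
    obtain ⟨k, hk⟩ := hc.pow_mem g
    exact ⟨k, by rw [← QuotientGroup.mk_pow]; exact (QuotientGroup.eq_one_iff _).2 hk⟩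
  set M' := M.map (QuotientGroup.mk' C)
  have hcomap : M'.comap (QuotientGroup.mk' C) = M := by
    rw [Subgroup.comap_map_eq, QuotientGroup.ker_mk', sup_eq_left.2 hCM]
  obtain ⟨m, hm⟩ := hp.exists_card_eq
  obtain ⟨n, hn⟩ := (hp.to_subgroup M').exists_card_eq
  have hnm : n < m := by
    by_contra! h
    refine hM' ?_
    rw [← hcomap, show M' = ⊤ from Subgroup.eq_top_of_le_card _ ?_, Subgroup.comap_top]
    rw [hm, hn]
    exact Nat.pow_le_pow_right two_pos h
  obtain ⟨m, rfl⟩ : ∃ k, m = k + 1 := ⟨m - 1, by omega⟩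
  obtain ⟨K, hK, hMK⟩ := Sylow.exists_subgroup_card_pow_prime_le (p := 2) (m := m)
    (by rw [hm]; exact pow_dvd_pow _ (by omega)) M' hn (by omega)
  refine ⟨K.comap (QuotientGroup.mk' C), ?_, ?_⟩
  · rw [Subgroup.index_comap_of_surjective _ (QuotientGroup.mk'_surjective C)]
    have := K.card_mul_index
    rw [hK, hm, pow_succ] at this
    exact Nat.eq_of_mul_eq_mul_left (by positivity) this
  · rw [← hcomap]
    exact Subgroup.comap_mono hMK

theorem exists_affine_of_isCoatom {c : G} (hodd : Odd (orderOf c))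
    (hnorm : (Subgroup.zpowers c).Normal) {K : Subgroup G} (hK : IsCoatom K) (hcK : c ∉ K) :
    ∃ (q : ℕ) (_ : Fact q.Prime) (α : G →* (ZMod q)ˣ) (β : G → ZMod q), Odd q ∧
      (∀ g h, β (g * h) = β g + α g * β h) ∧ α c = 1 ∧ β c = 1 ∧ ∀ g, g ∈ K ↔ β g = 0 := by
  have hsup : ∀ M : Subgroup G, M.Normal → (∃ m ∈ M, m ∉ K) → ∀ g, ∃ m ∈ M, m⁻¹ * g ∈ K := by
    rintro M _ ⟨m, hm, hmK⟩ g
    have : M ⊔ K = ⊤ := hK.2 _ (lt_of_le_of_ne le_sup_right fun h => hmK (h ▸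
      Subgroup.mem_sup_left hm))
    have hg : g ∈ M ⊔ K := this ▸ Subgroup.mem_top g
    rw [Subgroup.mem_sup_of_normal_left] at hg
    obtain ⟨y, hy, z, hz, rfl⟩ := hg
    exact ⟨y, hy, by simpa using hz⟩
  obtain ⟨q, hq, hqK⟩ : ∃ q : ℕ, q.Prime ∧ ∀ n : ℤ, c ^ n ∈ K ↔ (q : ℤ) ∣ n := by
    have hd : ∀ n : ℤ, c ^ n ∈ K ↔ (MulAction.period c ((1 : G) : G ⧸ K) : ℤ) ∣ n := by
      intro n
      rw [← MulAction.zpow_smul_eq_iff_period_dvd, MulAction.Quotient.smul_coe, eq_comm,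
        QuotientGroup.eq]
      simp
    set d := MulAction.period c ((1 : G) : G ⧸ K)
    have hd1 : d ≠ 1 := fun h => hcK (by simpa using (hd 1).2 (by simp [h]))
    have hq := Nat.minFac_prime hd1
    have hnorm' : (Subgroup.zpowers (c ^ d.minFac)).Normal := by
      refine ⟨fun n hn g => ?_⟩
      obtain ⟨i, rfl⟩ := Subgroup.mem_zpowers_iff.1 hn
      obtain ⟨a, ha⟩ := Subgroup.mem_zpowers_iff.1
        (hnorm.conj_mem c (Subgroup.mem_zpowers c) g)
      refine Subgroup.mem_zpowers_iff.2 ⟨a * i, ?_⟩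
      rw [← conj_zpow, ← conj_pow, ← ha]
      simp only [← zpow_natCast, ← zpow_mul]
      congr 1
      ring
    have hcq : c ^ d.minFac ∈ K := by
      by_contra h
      obtain ⟨m, hm, hmK⟩ := hsup _ hnorm' ⟨_, Subgroup.mem_zpowers _, h⟩ c
      obtain ⟨i, rfl⟩ := Subgroup.mem_zpowers_iff.1 hm
      have h1 : c ^ (1 - d.minFac * i : ℤ) ∈ K := by
        convert hmK using 1
        rw [← zpow_natCast, ← zpow_mul, ← zpow_neg, sub_eq_neg_add, zpow_add, zpow_one]
      rw [hd] at h1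
      have h2 := (Int.natCast_dvd_natCast.2 d.minFac_dvd).trans h1
      have h3 : (d.minFac : ℤ) ∣ 1 := by simpa using dvd_add h2 (dvd_mul_right _ i)
      exact hq.one_lt.ne' (by exact_mod_cast Int.eq_one_of_dvd_one (by positivity) h3)
    have hdq : d = d.minFac := by
      refine ((Nat.dvd_prime hq).1 ?_).resolve_left hd1
      have := (hd d.minFac).1 (by simpa using hcq)
      exact_mod_cast this
    exact ⟨d, hdq ▸ hq, hd⟩
  have : Fact q.Prime := ⟨hq⟩
  have hqodd : Odd q := by
    refine Odd.of_dvd_nat hodd ?_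
    have := (hqK (orderOf c)).1 (by simp [pow_orderOf_eq_one, one_mem])
    exact_mod_cast this
  have ha : ∀ g, ∃ a : ℤ, c ^ a = g * c * g⁻¹ := fun g =>
    Subgroup.mem_zpowers_iff.1 (hnorm.conj_mem c (Subgroup.mem_zpowers c) g)
  have hb : ∀ g, ∃ b : ℤ, c ^ (-b) * g ∈ K := fun g => by
    obtain ⟨m, hm, h⟩ := hsup _ hnorm ⟨c, Subgroup.mem_zpowers c, hcK⟩ g
    obtain ⟨b, rfl⟩ := Subgroup.mem_zpowers_iff.1 hm
    exact ⟨b, by rwa [zpow_neg]⟩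
  choose a ha using ha
  choose b hb using hb
  have ha' : ∀ g (n : ℤ), c ^ n = g * c * g⁻¹ → (a g : ZMod q) = n := by
    intro g n h
    rw [ZMod.intCast_eq_intCast_iff_dvd_sub, ← hqK, zpow_sub, h, ha, mul_inv_cancel]
    exact one_mem K
  have hb' : ∀ g (n : ℤ), c ^ (-n) * g ∈ K → (b g : ZMod q) = n := by
    intro g n h
    rw [ZMod.intCast_eq_intCast_iff_dvd_sub, ← hqK]
    have := mul_mem (hb g) (inv_mem h)
    convert this using 1
    rw [mul_inv_rev, ← zpow_neg, neg_neg, mul_assoc, mul_inv_cancel_left, ← zpow_add]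
    congr 1
    ring
  have hconj : ∀ g (n : ℤ), g * c ^ n * g⁻¹ = c ^ (a g * n) := by
    intro g n
    rw [zpow_mul, ha, conj_zpow]
  set A : G →* ZMod q :=
    { toFun := fun g => a g
      map_one' := by simpa using ha' 1 1 (by simp)
      map_mul' := fun g h => by
        have := ha' (g * h) (a g * a h) (by
          rw [← hconj, ha]
          group)
        simpa using this }
  refine ⟨q, this, A.toHomUnits, fun g => b g, hqodd, fun g h => ?_, ?_, ?_, fun g => ?_⟩
  · have := hb' (g * h) (b g + a g * b h) (by
      have := mul_mem (hb g) (hb h)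
      convert this using 1
      rw [neg_add, zpow_add, ← mul_neg, ← hconj]
      group)
    push_cast at this
    exact this
  · ext
    change (a c : ZMod q) = 1
    simpa using ha' c 1 (by simp)
  · simpa using hb' c 1 (by simp [one_mem])
  · have h1 : g ∈ K ↔ c ^ (-b g) ∈ K := by
      constructor
      · intro h
        simpa using mul_mem (hb g) (inv_mem h)
      · intro h
        simpa using mul_mem (inv_mem h) (hb g)
    rw [h1, hqK, dvd_neg, ← ZMod.intCast_zmod_eq_zero_iff_dvd]

theorem ind_one_mem_T_of_isQuasiElementary {c : G} (hc : IsQuasiElementary c) (H : Subgroup G) :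
    ind H.subtype 1 ∈ T G := by
  induction hn : Fintype.card G using Nat.strong_induction_on generalizing G with
  | _ n ih =>
  have ih' : ∀ {K : Subgroup G}, K ≠ ⊤ → ∀ L : Subgroup K, ind L.subtype 1 ∈ T K := by
    intro K hK L
    obtain ⟨d, hd⟩ := hc.comap K.subtype_injective
    refine ih _ ?_ hd L rfl
    rw [← hn, ← Nat.card_eq_fintype_card, ← Nat.card_eq_fintype_card]
    exact lt_of_le_of_ne K.card_le_card_group fun h => hK (Subgroup.eq_top_of_card_eq K h)
  have hlow : ∀ {M L : Subgroup G}, c ∈ M → M ≠ ⊤ → L ≤ M → ind L.subtype 1 ∈ T G := by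
    intro M L hcM hM hLM
    obtain ⟨K, hK, hMK⟩ := hc.exists_index_two hcM hM
    rw [← ind_subgroupOf (hLM.trans hMK)]
    refine ind_mem_T_of_index_two hK (ih' ?_ _)
    rintro rfl
    simp at hK
  by_cases hH : H = ⊤
  · rw [hH, ind_top_one]
    exact one_mem_T
  obtain ⟨K, hK, hHK⟩ := (eq_top_or_exists_le_coatom H).resolve_left hH
  by_cases hcK : c ∈ K
  · exact hlow hcK hK.1 hHK
  have hKT : ind K.subtype 1 ∈ T G := by
    obtain ⟨q, _, α, β, hq, hβ, hα1, hβ1, hKβ⟩ := exists_affine_of_isCoatom hc.odd hc.normal hK hcK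
    refine ind_one_mem_T_of_affine hq hβ hα1 hβ1 ?_ hKβ
    by_cases hα : α.ker = ⊤
    · have h := ind_top_one (G := G)
      rw [← hα] at h
      convert one_mem_T (G := G)
      convert h
    · convert hlow (L := α.ker) (MonoidHom.mem_ker.2 hα1) hα le_rfl
  obtain ⟨ε, k, hf⟩ := ih' hK.1 (H.subgroupOf K)
  have h1 := PP_le_T (ind_mem_PP K.subtype_injective hf)
  rw [map_sub, map_sub, map_zsmul, ind_subgroupOf hHK] at h1
  have h2 : ind K.subtype (sgn ε) ∈ T G := by
    by_cases hε : ε = 1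
    · simpa [hε] using hKT
    have h3 : sgn ε = ind ε.ker.subtype 1 - 1 := by
      rw [← one_add_sgn hε, add_sub_cancel_left]
    have h4 := ind_map_subtype ε.ker
    rw [h3, map_sub]
    refine sub_mem ?_ hKT
    obtain ⟨t, ht⟩ := DFunLike.ne_iff.1 hε
    have := hc.normal
    have h5 : Subgroup.zpowers c ⊔ ε.ker.map K.subtype ≠ ⊤ := by
      intro h
      have ht' : (t : G) ∈ Subgroup.zpowers c ⊔ ε.ker.map K.subtype := h ▸ Subgroup.mem_top _
      rw [Subgroup.mem_sup_of_normal_left] at ht'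
      obtain ⟨y, hy, _, ⟨l, hl, rfl⟩, hyl⟩ := ht'
      have hyK : y = (t * l⁻¹ : K) := by
        rw [← eq_mul_inv_iff_mul_eq] at hyl
        simpa using hyl
      have hodd : Odd (orderOf (t * l⁻¹)) := by
        rw [← Subgroup.orderOf_coe, ← hyK]
        exact Odd.of_dvd_nat hc.odd (orderOf_dvd_of_mem_zpowers hy)
      have hl' : ε l = 1 := hl
      have h6 : ε (t * l⁻¹) ^ orderOf (t * l⁻¹) = 1 := by
        rw [← map_pow, pow_orderOf_eq_one, map_one]
      rw [map_mul, map_inv, hl', inv_one, mul_one] at h6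
      rcases Int.units_eq_one_or (ε t) with h | h
      · exact ht h
      · rw [h, hodd.neg_one_pow] at h6
        exact absurd h6 (by decide)
    have h7 := hlow (Subgroup.mem_sup_left (Subgroup.mem_zpowers c)) h5 le_sup_right
    rw [← h4] at h7
    convert h7
  have := add_mem (add_mem h1 h2) (zsmul_mem hKT k)
  convert this using 1
  abel

theorem exists_isQuasiElementary_subgroup {c : G} (hodd : Odd (orderOf c)) :
    ∃ (H : Subgroup G) (hc : c ∈ H), IsQuasiElementary (⟨c, hc⟩ : H) ∧
      Odd (H.relIndex (Subgroup.normalizer (Subgroup.zpowers c))) := by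
  set C := Subgroup.zpowers c
  set N := Subgroup.normalizer (C : Set G)
  have hCN : C ≤ N := Subgroup.le_normalizer
  have : Fact (Nat.Prime 2) := ⟨Nat.prime_two⟩
  obtain ⟨S⟩ : Nonempty (Sylow 2 N) := inferInstance
  set S' := (S : Subgroup N).map N.subtype
  have hS'N : S' ≤ N := Subgroup.map_subtype_le _
  have hcH : c ∈ C ⊔ S' := Subgroup.mem_sup_left (Subgroup.mem_zpowers c)
  have hHN : C ⊔ S' ≤ N := sup_le hCN hS'N
  have hmem : ∀ y : (C ⊔ S' : Subgroup G), y ∈ Subgroup.zpowers (⟨c, hcH⟩ : (C ⊔ S' : Subgroup G)) ↔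
      (y : G) ∈ C := by
    intro y
    simp only [C, Subgroup.mem_zpowers_iff, Subtype.ext_iff, Subgroup.coe_zpow]
  refine ⟨C ⊔ S', hcH, ⟨?_, ⟨fun n hn g => ?_⟩, fun g => ?_⟩, ?_⟩
  · rwa [Subgroup.orderOf_mk]
  · rw [hmem] at hn ⊢
    exact (Subgroup.mem_normalizer_iff.1 (hHN g.2) n).1 hn
  · have hg : (g : G) ∈ ((C ⊔ S' : Subgroup G) : Set G) := g.2
    rw [Subgroup.coe_mul_of_right_le_normalizer_left C S' hS'N] at hg
    obtain ⟨y, hy, _, ⟨s, hs, rfl⟩, hys⟩ := hg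
    obtain ⟨k, hk⟩ := S.isPGroup' ⟨s, hs⟩
    have hk' : (s : G) ^ 2 ^ k = 1 := by
      simpa [Subtype.ext_iff] using hk
    have key : ∀ n : ℕ, ∃ z ∈ C, (y * s) ^ n = z * (s : G) ^ n := by
      intro n
      induction n with
      | zero => exact ⟨1, one_mem C, by simp⟩
      | succ n ih =>
        obtain ⟨z, hz, h⟩ := ih
        refine ⟨z * ((s : G) ^ n * y * ((s : G) ^ n)⁻¹), mul_mem hz
          ((Subgroup.mem_normalizer_iff.1 (pow_mem s.2 n) y).1 hy), ?_⟩
        rw [pow_succ, h, pow_succ]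
        group
    refine ⟨k, ?_⟩
    rw [hmem]
    obtain ⟨z, hz, h⟩ := key (2 ^ k)
    rw [hk', mul_one] at h
    change y * s = g at hys
    rw [Subgroup.coe_pow, ← hys, h]
    exact hz
  · have h1 : (C ⊔ S').relIndex N ∣ S'.relIndex N := Subgroup.relIndex_dvd_of_le_left _ le_sup_right
    have h2 : S'.relIndex N = (S : Subgroup N).index := by
      rw [Subgroup.relIndex, Subgroup.subgroupOf, Subgroup.comap_map_eq_self_of_injective
        N.subtype_injective]
    rw [h2] at h1
    refine Odd.of_dvd_nat ?_ h1
    rw [← Nat.not_even_iff_odd, even_iff_two_dvd]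
    exact S.not_dvd_index

theorem fixChar_apply (X : Type) [MulAction G X] [Fintype X] (g : G) :
    fixChar G X g = Fintype.card {x : X // g • x = x} := by
  rw [Fintype.card_subtype, ← Finset.sum_boole]
  rfl

theorem exists_odd_ind_one_apply (x : G) : ∃ (H : Subgroup G) (c : H), IsQuasiElementary c ∧
    ∃ n : ℤ, Odd n ∧ ind H.subtype 1 x = n := by
  obtain ⟨a, m, hm, hx⟩ := Nat.exists_eq_two_pow_mul_odd (orderOf_pos x).ne'
  set c := x ^ 2 ^ a
  have hc : orderOf c = m := by
    rw [orderOf_pow_of_dvd (by positivity) (hx ▸ dvd_mul_right _ _), hx]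
    exact Nat.mul_div_cancel_left _ (by positivity)
  obtain ⟨H, hcH, hH, hodd⟩ := exists_isQuasiElementary_subgroup (c := c) (hc ▸ hm)
  set N := Subgroup.normalizer (Subgroup.zpowers c : Set G)
  refine ⟨H, ⟨c, hcH⟩, hH, ?_⟩
  have hzH : ∀ y : H, y ∈ Subgroup.zpowers (⟨c, hcH⟩ : H) → (y : G) ∈ Subgroup.zpowers c := by
    intro y hy
    obtain ⟨k, rfl⟩ := Subgroup.mem_zpowers_iff.1 hy
    exact Subgroup.mem_zpowers_iff.2 ⟨k, by simp⟩
  have hsm : ∀ n : N, n • ((1 : G) : G ⧸ H) = ((n : G) : G ⧸ H) := fun n => by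
    change (((n : G) * 1 : G) : G ⧸ H) = _
    rw [mul_one]
  have horb : {y : G ⧸ H | c • y = y} = MulAction.orbit N ((1 : G) : G ⧸ H) := by
    ext y
    obtain ⟨g, rfl⟩ := QuotientGroup.mk_surjective y
    rw [Set.mem_ofPred_eq, MulAction.Quotient.smul_coe, eq_comm, QuotientGroup.eq, smul_eq_mul,
      ← mul_assoc]
    constructor
    · intro h
      refine ⟨⟨g, ?_⟩, hsm _⟩
      have h1 : g⁻¹ * c * g ∈ Subgroup.zpowers c := by
        obtain ⟨k, hk⟩ := hH.pow_mem ⟨_, h⟩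
        have ho : orderOf (g⁻¹ * c * g) = m := by
          rw [← hc]
          exact orderOf_injective (MulAut.conj g⁻¹).toMonoidHom (MulAut.conj g⁻¹).injective c ▸
            by simp
        obtain ⟨j, hj⟩ := exists_pow_eq_self_of_coprime (x := g⁻¹ * c * g) (n := 2 ^ k)
          (by rw [ho]; exact Nat.Coprime.pow_left _ (Nat.coprime_two_left.2 hm))
        rw [← hj]
        exact pow_mem (hzH _ hk) j
      rw [← inv_mem_iff]
      refine Subgroup.mem_normalizer_fintype fun z hz => ?_
      obtain ⟨k, rfl⟩ := Subgroup.mem_zpowers_iff.1 hz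
      rw [← conj_zpow, inv_inv]
      exact zpow_mem h1 k
    · rintro ⟨⟨n, hn⟩, h⟩
      have h1 : (n : G ⧸ H) = g := (hsm _).symm.trans h
      rw [QuotientGroup.eq] at h1
      have h2 : n⁻¹ * c * n ∈ H :=
        Subgroup.zpowers_le.2 hcH
          ((Subgroup.mem_normalizer_iff''.1 hn c).1 (Subgroup.mem_zpowers c))
      convert mul_mem (mul_mem (inv_mem h1) h2) h1 using 1
      group
  have hcard : Fintype.card {y : G ⧸ H // c • y = y} = H.relIndex N := by
    have hst : MulAction.stabilizer N ((1 : G) : G ⧸ H) = H.subgroupOf N := by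
      ext n
      rw [MulAction.mem_stabilizer_iff, hsm, eq_comm, QuotientGroup.eq, Subgroup.mem_subgroupOf]
      simp
    rw [Subgroup.relIndex, ← hst, MulAction.index_stabilizer, ← horb, ← Nat.card_eq_fintype_card]
    rfl
  have hcomm : Commute c x := (Commute.refl x).pow_left _
  let f : Function.End {y : G ⧸ H // c • y = y} := fun y => ⟨x • y.1, by
    rw [smul_smul, hcomm.eq, mul_smul, y.2]⟩
  have hf : ∀ k : ℕ, ∀ y, ((f ^ k) y : G ⧸ H) = x ^ k • y.1 := by
    intro k
    induction k with
    | zero => intro y; rw [pow_zero, pow_zero, one_smul]; rfl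
    | succ k ih =>
      intro y
      rw [pow_succ, pow_succ, mul_smul]
      exact ih (f y)
  have : Fact (Nat.Prime 2) := ⟨Nat.prime_two⟩
  have hmod := Equiv.Perm.card_fixedPoints_modEq (f := f) (p := 2) (n := a)
    (by funext y; apply Subtype.ext; exact (hf _ y).trans y.2)
  rw [hcard] at hmod
  have hfix : ind H.subtype 1 x = Fintype.card {y : G ⧸ H // x • y = y} := by
    rw [← fixChar_quotient, fixChar_apply]
    congr!
  have hfix' : Fintype.card {y : G ⧸ H // x • y = y} = Fintype.card f.fixedPoints := by
    refine Fintype.card_congr ⟨fun y => ⟨⟨y.1, ?_⟩, Subtype.ext y.2⟩,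
      fun y => ⟨y.1.1, congrArg Subtype.val y.2⟩, fun y => rfl, fun y => rfl⟩
    have hy : ∀ k : ℕ, x ^ k • y.1 = y.1 := by
      intro k
      induction k with
      | zero => rw [pow_zero, one_smul]
      | succ k ih => rw [pow_succ, mul_smul, y.2, ih]
    exact hy _
  refine ⟨Fintype.card f.fixedPoints, ?_, by rw [hfix, hfix', Int.cast_natCast]⟩
  rw [Nat.ModEq, Nat.odd_iff.1 hodd] at hmod
  exact_mod_cast Nat.odd_iff.2 hmod.symm

/-- The generalised permutation characters multiplying even permutation characters to `PP G`. -/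
def multipliers (G : Type) [Group G] [Fintype G] : AddSubgroup (G → ℂ) where
  carrier := {r | r ∈ perm G ∧ ∀ f, IsEvenPerm f → r * f ∈ PP G}
  zero_mem' := ⟨zero_mem _, fun f _ => by rw [zero_mul]; exact zero_mem _⟩
  add_mem' := fun ha hb => ⟨add_mem ha.1 hb.1, fun f hf => by
    rw [add_mul]
    exact add_mem (ha.2 f hf) (hb.2 f hf)⟩
  neg_mem' := fun ha => ⟨neg_mem ha.1, fun f hf => by
    rw [neg_mul]
    exact neg_mem (ha.2 f hf)⟩

theorem isEvenPerm_of_mem {f : G → ℂ} (hf : f ∈ perm G) (h : f ∈ PP G) : IsEvenPerm f where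
  mem := hf
  apply_one := apply_one_of_mem_PP h
  even g := by simpa using (PP_le_multsIn h).2 g (-1) (by norm_num)

theorem mul_mem_multipliers {r s : G → ℂ} (hr : r ∈ multipliers G) (hs : s ∈ multipliers G) :
    r * s ∈ multipliers G :=
  ⟨mul_mem_perm hr.1 hs.1, fun f hf => by
    rw [mul_assoc]
    exact hr.2 _ (isEvenPerm_of_mem (mul_mem_perm hs.1 hf.mem) (hs.2 f hf))⟩

theorem ind_one_mem_multipliers {H : Subgroup G} {c : H} (hc : IsQuasiElementary c) :
    ind H.subtype 1 ∈ multipliers G := by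
  refine ⟨ind_one_mem_perm H, fun f hf => ?_⟩
  rw [← ind_mul_comp _ _ (isClassFun_of_mem_perm hf.mem)]
  have h1 := hf.comp H.subtype H.subtype_injective
  have h2 : (fun h => f (H.subtype h)) ∈ PP H :=
    mem_PP_of_mem_T (perm_le_of_ind_one_mem (ind_one_mem_T_of_isQuasiElementary hc) h1.mem) h1
  simpa using ind_mem_PP H.subtype_injective h2

theorem exists_odd_zsmul_one_mem_multipliers :
    ∃ n : ℤ, Odd n ∧ n • (1 : G → ℂ) ∈ multipliers G := by
  have key : ∀ s : Finset G, ∃ n : ℤ, Odd n ∧ ∃ r ∈ multipliers G, ∀ x ∈ s, r x = n := by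
    intro s
    induction s using Finset.induction_on with
    | empty => exact ⟨1, odd_one, 0, zero_mem _, by simp⟩
    | insert x s _ ih =>
      obtain ⟨n, hn, r, hr, hrs⟩ := ih
      obtain ⟨H, c, hc, m, hm, hx⟩ := exists_odd_ind_one_apply x
      have h := ind_one_mem_multipliers hc
      refine ⟨n * m, hn.mul hm, n • ind H.subtype 1 + m • r - r * ind H.subtype 1,
        sub_mem (add_mem (zsmul_mem h n) (zsmul_mem hr m)) (mul_mem_multipliers hr h), ?_⟩
      intro y hy
      simp only [Pi.sub_apply, Pi.add_apply, Pi.smul_apply, Pi.mul_apply]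
      simp only [zsmul_eq_mul]
      rcases Finset.mem_insert.1 hy with rfl | hy
      · rw [hx]
        push_cast
        ring
      · rw [hrs y hy]
        push_cast
        ring
  obtain ⟨n, hn, r, hr, h⟩ := key Finset.univ
  refine ⟨n, hn, ?_⟩
  convert hr using 1
  ext x
  simp [h x]

theorem mem_PP_of_isEvenPerm {f : G → ℂ} (hf : IsEvenPerm f) : f ∈ PP G := by
  obtain ⟨n, ⟨k, rfl⟩, hn⟩ := exists_odd_zsmul_one_mem_multipliers (G := G)
  have h1 := hn.2 f hf
  have h2 := two_mem_PP (perm_le_mono hf.mem) hf.apply_one (conjFun_of_mem_perm hf.mem)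
  convert sub_mem h1 (zsmul_mem h2 k) using 1
  ext g
  simp
  ring

/-- An endomorphism of finite order of a complex vector space is diagonalisable. -/
theorem exists_eigenbasis {V : Type} [AddCommGroup V] [Module ℂ V] [FiniteDimensional ℂ V]
    (t : Module.End ℂ V) {N : ℕ} (hN : N ≠ 0) (ht : t ^ N = 1) :
    ∃ (n : ℕ) (b : Module.Basis (Fin n) ℂ V) (a : Fin n → ℂ), ∀ i, t (b i) = a i • b i := by
  have hs : t.IsSemisimple := by
    refine Module.End.isSemisimple_of_squarefree_aeval_eq_zero (p := Polynomial.X ^ N - 1)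
      (Polynomial.Separable.squarefree ?_) (by simp [ht])
    exact Polynomial.separable_X_pow_sub_C (1 : ℂ) (by exact_mod_cast hN) one_ne_zero
  let hd := DirectSum.isInternal_submodule_of_iSupIndep_of_iSup_eq_top t.eigenspaces_iSupIndep
    hs.iSup_eigenspace_eq_top
  let b := hd.collectedBasis fun μ => Module.finBasis ℂ (t.eigenspace μ)
  have hb : ∀ i, t (b i) = i.1 • b i := fun i =>
    Module.End.mem_eigenspace_iff.1 (hd.collectedBasis_mem _ i)
  let _ : Fintype (Σ μ : ℂ, Fin (Module.finrank ℂ (t.eigenspace μ))) :=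
    FiniteDimensional.fintypeBasisIndex b
  refine ⟨_, b.reindex (Fintype.equivFin _), fun i => ((Fintype.equivFin _).symm i).1, fun i => ?_⟩
  rw [Module.Basis.reindex_apply, hb]

theorem toMatrix_eq_diagonal {V ι : Type} [AddCommGroup V] [Module ℂ V] [Fintype ι]
    [DecidableEq ι] {t : Module.End ℂ V} {b : Module.Basis ι ℂ V} {a : ι → ℂ}
    (h : ∀ i, t (b i) = a i • b i) :
    LinearMap.toMatrix b b t = Matrix.diagonal a := by
  ext i j
  rw [LinearMap.toMatrix_apply, h, map_smul, Module.Basis.repr_self, Matrix.diagonal_apply]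
  simp [Finsupp.single_apply, eq_comm]
  grind

/-- The multiplicity of `u` in a difference of two families of complex numbers. -/
def multDiff {m n : ℕ} (a : Fin m → ℂ) (b : Fin n → ℂ) (u : ℂ) : ℤ :=
  (Finset.univ.filter fun i => a i = u).card - (Finset.univ.filter fun j => b j = u).card

theorem sum_pow_eq {n N : ℕ} {a : Fin n → ℂ} (ha : ∀ i, a i ^ N = 1) {u : ℂ} (hu : u ^ N = 1)
    (hN : N ≠ 0) :
    ∑ k ∈ Finset.range N, u⁻¹ ^ k * ∑ i, a i ^ k =
      N * (Finset.univ.filter fun i => a i = u).card := by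
  have hu0 : u ≠ 0 := fun h => by simp [h, hN] at hu
  simp_rw [Finset.mul_sum]
  rw [Finset.sum_comm, Finset.card_filter, Nat.cast_sum, Finset.mul_sum]
  refine Finset.sum_congr rfl fun i _ => ?_
  simp_rw [← mul_pow]
  split_ifs with h
  · simp [h, hu0]
  · have h1 : u⁻¹ * a i ≠ 1 := fun h' => h (by field_simp at h'; exact h')
    have h2 := geom_sum_mul (u⁻¹ * a i) N
    rw [mul_pow, inv_pow, hu, ha, inv_one, mul_one, sub_self] at h2
    rw [(mul_eq_zero.1 h2).resolve_right (sub_ne_zero.2 h1)]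
    simp

theorem prod_eq_prod_pow {n N : ℕ} {a : Fin n → ℂ} (ha : ∀ i, a i ^ N = 1) (hN : 0 < N) :
    ∏ i, a i = ∏ u ∈ Polynomial.nthRootsFinset N (1 : ℂ),
      u ^ (Finset.univ.filter fun i => a i = u).card := by
  rw [← Finset.prod_fiberwise_of_maps_to' (t := Polynomial.nthRootsFinset N (1 : ℂ)) (g := a)
    (f := fun u => u) fun i _ => (Polynomial.mem_nthRootsFinset hN (1 : ℂ)).2 (ha i)]
  exact Finset.prod_congr rfl fun u _ => Finset.prod_const _

theorem conj_eq_inv {u : ℂ} {N : ℕ} (hN : N ≠ 0) (hu : u ^ N = 1) : starRingEnd ℂ u = u⁻¹ :=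
  (Complex.inv_eq_conj (Complex.norm_eq_one_of_pow_eq_one hu hN)).symm

/-- If a virtual family of roots of unity has real power sums and product `1`, then `-1` occurs
in it with even multiplicity. -/
theorem even_multDiff {m n N : ℕ} {a : Fin m → ℂ} {b : Fin n → ℂ} (hN : N ≠ 0) (hN2 : Even N)
    (ha : ∀ i, a i ^ N = 1) (hb : ∀ j, b j ^ N = 1)
    (hr : ∀ k : ℕ, starRingEnd ℂ (∑ i, a i ^ k - ∑ j, b j ^ k) = ∑ i, a i ^ k - ∑ j, b j ^ k)
    (hd : (∏ i, a i) * starRingEnd ℂ (∏ j, b j) = 1) : Even (multDiff a b (-1)) := by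
  have hN' := Nat.pos_of_ne_zero hN
  have key : ∀ u : ℂ, u ^ N = 1 →
      ∑ k ∈ Finset.range N, u⁻¹ ^ k * (∑ i, a i ^ k - ∑ j, b j ^ k) = N * (multDiff a b u : ℂ) := by
    intro u hu
    simp_rw [mul_sub]
    rw [Finset.sum_sub_distrib, sum_pow_eq ha hu hN, sum_pow_eq hb hu hN, multDiff]
    push_cast
    ring
  have hsymm : ∀ u : ℂ, u ^ N = 1 → multDiff a b u⁻¹ = multDiff a b u := by
    intro u hu
    have h := congrArg (starRingEnd ℂ) (key u hu)
    simp only [map_sum, map_mul, map_pow, hr, map_natCast, map_intCast, map_inv₀,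
      conj_eq_inv hN hu] at h
    rw [key u⁻¹ (by rw [inv_pow, hu, inv_one])] at h
    exact_mod_cast mul_left_cancel₀ (by exact_mod_cast hN) h
  have hmem : ∀ {u : ℂ}, u ∈ Polynomial.nthRootsFinset N (1 : ℂ) ↔ u ^ N = 1 :=
    Polynomial.mem_nthRootsFinset hN' 1
  have h0 : ∀ u ∈ Polynomial.nthRootsFinset N (1 : ℂ), u ≠ 0 := fun u hu h => by
    simp [hmem, h, hN] at hu
  have hprod : ∏ u ∈ Polynomial.nthRootsFinset N (1 : ℂ), u ^ multDiff a b u = 1 := by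
    have hbN : (∏ j, b j) ^ N = 1 := by
      rw [← Finset.prod_pow]
      exact Finset.prod_eq_one fun j _ => hb j
    rw [conj_eq_inv hN hbN, prod_eq_prod_pow ha hN', prod_eq_prod_pow hb hN',
      ← Finset.prod_inv_distrib, ← Finset.prod_mul_distrib] at hd
    refine (Finset.prod_congr rfl fun u hu => ?_).trans hd
    rw [multDiff, zpow_sub₀ (h0 u hu), zpow_natCast, zpow_natCast, div_eq_mul_inv]
  have h1 : (-1 : ℂ) ∈ Polynomial.nthRootsFinset N (1 : ℂ) := hmem.2 hN2.neg_one_pow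
  have hrest : ∏ u ∈ (Polynomial.nthRootsFinset N (1 : ℂ)).erase (-1), u ^ multDiff a b u = 1 := by
    refine Finset.prod_involution (fun u _ => u⁻¹) ?_ ?_ ?_ ?_
    · intro u hu
      have hu := Finset.mem_of_mem_erase hu
      rw [hsymm u (hmem.1 hu), inv_zpow, mul_inv_cancel₀ (zpow_ne_zero _ (h0 u hu))]
    · intro u hu h h'
      have h2 := h0 u (Finset.mem_of_mem_erase hu)
      have h3 : u * u = 1 := by nth_rw 1 [← h']; exact inv_mul_cancel₀ h2
      rcases mul_self_eq_one_iff.1 h3 with rfl | rfl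
      · simp at h
      · simp at hu
    · intro u hu
      obtain ⟨h2, h3⟩ := Finset.mem_erase.1 hu
      refine Finset.mem_erase.2 ⟨fun h => h2 ?_, hmem.2 ?_⟩
      · rw [← inv_inv u, h]; norm_num
      · rw [inv_pow, hmem.1 h3, inv_one]
    · intro u _
      exact inv_inv u
  rw [← Finset.mul_prod_erase _ _ h1, hrest, mul_one] at hprod
  by_contra h
  rw [Int.not_even_iff_odd] at h
  rw [h.neg_one_zpow] at hprod
  norm_num at hprod

theorem exists_eigenvalues (V : FDRep ℂ G) (g : G) : ∃ (n : ℕ) (a : Fin n → ℂ),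
    (∀ i, a i ^ (2 * orderOf g) = 1) ∧ (∀ k : ℕ, V.character (g ^ k) = ∑ i, a i ^ k) ∧
      detRep V g = ∏ i, a i := by
  have ht : V.ρ g ^ (2 * orderOf g) = 1 := by
    rw [← map_pow, mul_comm, pow_mul, pow_orderOf_eq_one, one_pow, map_one]
  obtain ⟨n, b, a, h⟩ := exists_eigenbasis (V.ρ g)
    (mul_ne_zero two_ne_zero (orderOf_pos g).ne') ht
  have hk : ∀ (k : ℕ) i, V.ρ (g ^ k) (b i) = (a i ^ k) • b i := by
    intro k i
    rw [map_pow]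
    induction k with
    | zero => simp
    | succ k ih => rw [pow_succ', Module.End.mul_apply, ih, map_smul, h, smul_smul, pow_succ]
  refine ⟨n, a, fun i => ?_, fun k => ?_, ?_⟩
  · have h1 := hk (2 * orderOf g) i
    rw [map_pow, ht, Module.End.one_apply] at h1
    exact (smul_left_injective ℂ (b.ne_zero i) (by simpa using h1)).symm
  · rw [FDRep.character, LinearMap.trace_eq_matrix_trace ℂ b, toMatrix_eq_diagonal (hk k),
      Matrix.trace_diagonal]
  · rw [detRep, ← LinearMap.det_toMatrix b, toMatrix_eq_diagonal h, Matrix.det_diagonal]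

theorem isEvenPerm_of_hasTrivialDet {f : G → ℂ} (hf : f ∈ perm G) (h0 : f 1 = 0)
    (hd : HasTrivialDet f) : IsEvenPerm f where
  mem := hf
  apply_one := h0
  even g := by
    obtain ⟨V, W, rfl, hVW⟩ := hd
    obtain ⟨m, a, ha, hVa, hVd⟩ := exists_eigenvalues V g
    obtain ⟨n, b, hb, hWb, hWd⟩ := exists_eigenvalues W g
    have hN : 2 * orderOf g ≠ 0 := mul_ne_zero two_ne_zero (orderOf_pos g).ne'
    have heven := even_multDiff hN (even_two_mul _) ha hb
      (fun k => by
        rw [← hVa, ← hWb]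
        exact congrFun (conjFun_of_mem_perm hf) (g ^ k))
      (by rw [← hVd, ← hWd, hVW])
    obtain ⟨k, hk⟩ := heven
    refine ⟨k, ?_⟩
    have h1 : ((-1 : ℂ)) ^ (2 * orderOf g) = 1 := (even_two_mul _).neg_one_pow
    have h2 : ∀ {l : ℕ} {c : Fin l → ℂ}, (∀ i, c i ^ (2 * orderOf g) = 1) →
        ∑ k ∈ Finset.range (2 * orderOf g), (-1 : ℂ) ^ k * ∑ i, c i ^ k =
          (2 * orderOf g : ℂ) * (Finset.univ.filter fun i => c i = -1).card := fun hc => by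
      simpa using sum_pow_eq hc h1 hN
    have h3 : (2 * orderOf g : ℂ) ≠ 0 := by exact_mod_cast hN
    rw [two_mul, ← Int.cast_add, ← hk, mult_apply, multDiff, inv_mul_eq_iff_eq_mul₀ h3]
    simp_rw [Pi.sub_apply, hVa, hWb, mul_sub]
    rw [Finset.sum_sub_distrib, h2 ha, h2 hb]
    push_cast
    ring

/-- The left regular representation on functions. -/
def leftReg (G : Type) [Group G] : G →* Module.End ℂ (G → ℂ) where
  toFun g := LinearMap.funLeft ℂ ℂ fun x => g⁻¹ * x
  map_one' := by ext; simp [LinearMap.funLeft_apply]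
  map_mul' g h := by ext; simp [LinearMap.funLeft_apply, mul_assoc]

@[simp] theorem leftReg_apply (g x : G) (F : G → ℂ) : leftReg G g F x = F (g⁻¹ * x) := rfl

/-- The idempotent cutting the representation induced from `l` out of the regular one. -/
def cut (φ : H →* G) (l : H →* ℂ) : Module.End ℂ (G → ℂ) :=
  (Fintype.card H : ℂ)⁻¹ • ∑ h, l h • LinearMap.funLeft ℂ ℂ fun x => x * φ h

theorem cut_apply (φ : H →* G) (l : H →* ℂ) (F : G → ℂ) (x : G) :
    cut φ l F x = (Fintype.card H : ℂ)⁻¹ * ∑ h, l h * F (x * φ h) := by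
  simp [cut, LinearMap.funLeft_apply]

theorem cut_cut (φ : H →* G) (l : H →* ℂ) (F : G → ℂ) : cut φ l (cut φ l F) = cut φ l F := by
  ext x
  have key : ∀ h : H, l h * ∑ h', l h' * F (x * φ h * φ h') = ∑ h', l h' * F (x * φ h') := by
    intro h
    rw [← Equiv.sum_comp (Equiv.mulLeft h) fun h' => l h' * F (x * φ h'), Finset.mul_sum]
    simp [mul_assoc]
  simp_rw [cut_apply, mul_left_comm (l _), key]
  rw [Finset.sum_const, Finset.card_univ, nsmul_eq_mul, mul_inv_cancel_left₀ card_ne_zero]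

theorem cut_leftReg (φ : H →* G) (l : H →* ℂ) (g : G) (F : G → ℂ) :
    cut φ l (leftReg G g F) = leftReg G g (cut φ l F) := by
  ext x
  simp [cut_apply, mul_assoc]

theorem trace_leftReg_cut (φ : H →* G) (l : H →* ℂ) (g : G) :
    LinearMap.trace ℂ _ (leftReg G g ∘ₗ cut φ l) = ind φ l g := by
  rw [LinearMap.trace_eq_matrix_trace ℂ (Pi.basisFun ℂ G), Matrix.trace, ind_apply, Finset.mul_sum]
  refine Finset.sum_congr rfl fun x _ => ?_
  rw [Matrix.diag_apply, LinearMap.toMatrix_apply, Pi.basisFun_repr, LinearMap.comp_apply,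
    leftReg_apply, cut_apply]
  congr 1
  refine Finset.sum_congr rfl fun h _ => ?_
  have : g⁻¹ * x * φ h = x ↔ φ h = x⁻¹ * g * x := by
    constructor <;> intro h'
    · rw [← eq_inv_mul_iff_mul_eq] at h'
      rw [h']; group
    · rw [h']; group
  simp [Pi.single_apply, this]

theorem isChar_ind (φ : H →* G) (l : H →* ℂ) : IsChar (ind φ l) := by
  set W := LinearMap.range (cut φ l)
  have hW : ∀ g, ∀ F ∈ W, leftReg G g F ∈ W := by
    rintro g _ ⟨F, rfl⟩
    exact ⟨_, cut_leftReg φ l g F⟩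
  let ρ : Representation ℂ G W :=
    { toFun := fun g => (leftReg G g).restrict (hW g)
      map_one' := by ext; simp
      map_mul' := fun g h => by ext; simp }
  refine ⟨FDRep.of ρ, ?_⟩
  ext g
  rw [← trace_leftReg_cut]
  have hmem : ∀ F, (leftReg G g ∘ₗ cut φ l) F ∈ W := fun F => hW g _ ⟨F, rfl⟩
  rw [← LinearMap.trace_restrict_eq_of_forall_mem W _ hmem]
  change LinearMap.trace ℂ W (ρ g) = _
  congr 1
  ext ⟨F, F', hF⟩ : 2
  change leftReg G g F = leftReg G g (cut φ l F)
  rw [← hF, cut_cut]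

theorem isGenChar_of_mem_mono {f : G → ℂ} (hf : f ∈ mono G) : IsGenChar f := by
  refine (AddSubgroup.closure_le (K := (Submodule.span ℤ {f | IsChar f}).toAddSubgroup)).2 ?_ hf
  rintro _ ⟨H, _, _, φ, l, -, rfl⟩
  exact Submodule.subset_span (isChar_ind φ l)

theorem mem_perm_of_isPermChar {f : G → ℂ} (hf : IsPermChar f) : f ∈ perm G := by
  refine (Submodule.span_le (p := (perm G).toIntSubmodule)).2 ?_ hf
  rintro _ ⟨H, rfl⟩
  rw [← ind_subtype]
  exact ind_one_mem_perm H

theorem IsTargetGroup.of_mulEquiv {Q R : Type} [Group Q] [Group R] (e : R ≃* Q)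
    (h : IsTargetGroup Q) : IsTargetGroup R := by
  obtain ⟨⟨i⟩⟩ | ⟨⟨i⟩⟩ | ⟨p, hp, hp', ⟨i⟩⟩ := h
  · exact .inl ⟨e.trans i⟩
  · exact .inr (.inl ⟨e.trans i⟩)
  · exact .inr (.inr ⟨p, hp, hp', ⟨e.trans i⟩⟩)

theorem isTargetGroup_units : IsTargetGroup (ℤˣ × ℤˣ) := by
  have e : ℤˣ ≃* Multiplicative (ZMod 2) := mulEquivOfPrimeCardEq (p := 2) (by simp) (by simp)
  exact .inl ⟨(e.prodCongr e).trans (MulEquiv.prodMultiplicative _ _).symm⟩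

theorem isTargetGroup_dihedralGroup {n : ℕ} (hn : n = 4 ∨ Odd n ∧ n.Prime) :
    IsTargetGroup (DihedralGroup n) := by
  obtain rfl | ⟨h, h'⟩ := hn
  · exact .inr (.inl ⟨.refl _⟩)
  · exact .inr (.inr ⟨n, h, h', ⟨.refl _⟩⟩)


theorem ind_matrix_mem {P : Set (G → ℂ)}
    (h2 : ∀ (H : Subgroup G) (N : Subgroup ↥H) [N.Normal] (V : FDRep ℂ ↥H),
      V.character 1 = 2 → IsTargetGroup (↥H ⧸ N) → (∀ n : ↥H, n ∈ N → V.ρ n = 1) →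
      indChar H (V.character - 1 - detRep V) ∈ P)
    {φ : H →* G} (hφ : Function.Injective φ) {Q : Type} [Group Q] (hQ : IsTargetGroup Q)
    {q : H →* Q} (hq : Function.Surjective q) (M : Q →* Matrix (Fin 2) (Fin 2) ℂ) :
    ind φ (fun h => (M (q h)).trace - 1 - (M (q h)).det) ∈ P := by
  let q' : φ.range →* Q := q.comp (φ.ofInjective hφ).symm.toMonoidHom
  have hq' : Function.Surjective q' := hq.comp (φ.ofInjective hφ).symm.surjective
  let ρ : Representation ℂ φ.range (Fin 2 → ℂ) :=
    ((Matrix.toLinAlgEquiv' : Matrix (Fin 2) (Fin 2) ℂ ≃ₐ[ℂ] _).toMonoidHom.comp M).comp q'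
  have hρ : ∀ x, ρ x = Matrix.toLin' (M (q' x)) := fun _ => rfl
  have hchar : ∀ x, (FDRep.of ρ).character x = (M (q' x)).trace := fun x => by
    rw [← Matrix.trace_toLin'_eq, ← hρ]; rfl
  have hdet : ∀ x, detRep (FDRep.of ρ) x = (M (q' x)).det := fun x => by
    rw [← LinearMap.det_toLin', ← hρ]; rfl
  rw [ind_eq_indChar hφ]
  convert h2 φ.range q'.ker (FDRep.of ρ) (by rw [hchar]; simp)
    (IsTargetGroup.of_mulEquiv (QuotientGroup.quotientKerEquivOfSurjective q' hq') hQ)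
    (fun n hn => by
      change ρ n = 1
      rw [hρ, MonoidHom.mem_ker.1 hn, map_one]
      exact Matrix.toLin'_one) using 2
  ext x
  simp only [Pi.sub_apply, Pi.one_apply, hchar, hdet]
  rfl

/-- The diagonal representation of `ℤˣ × ℤˣ`. -/
def diagUnits : ℤˣ × ℤˣ →* Matrix (Fin 2) (Fin 2) ℂ where
  toFun x := !![((x.1 : ℤ) : ℂ), 0; 0, ((x.2 : ℤ) : ℂ)]
  map_one' := by simp [Matrix.one_fin_two]
  map_mul' x y := by simp

/-- The two-dimensional representation of a dihedral group induced from a character of the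
rotation subgroup. -/
def dihMatrix {n : ℕ} (ψ : AddChar (ZMod n) ℂ) : DihedralGroup n →* Matrix (Fin 2) (Fin 2) ℂ where
  toFun
    | .r i => !![ψ i, 0; 0, ψ (-i)]
    | .sr i => !![0, ψ (-i); ψ i, 0]
  map_one' := by
    change !![ψ 0, 0; 0, ψ (-0)] = _
    simp [Matrix.one_fin_two]
  map_mul' := by
    rintro (i | i) (j | j) <;>
      simp [← AddChar.map_add_eq_mul, sub_eq_add_neg, add_comm]

theorem eq_one_or_eq_of_not_surjective {ε₁ ε₂ : G →* ℤˣ}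
    (h : ¬ Function.Surjective (ε₁.prod ε₂)) : ε₁ = 1 ∨ ε₂ = 1 ∨ ε₂ = ε₁ := by
  by_contra! h'
  obtain ⟨h1, h2, h3⟩ := h'
  obtain ⟨x, hx⟩ := DFunLike.ne_iff.1 h1
  obtain ⟨y, hy⟩ := DFunLike.ne_iff.1 h2
  obtain ⟨z, hz⟩ := DFunLike.ne_iff.1 h3
  refine h fun t => ?_
  have key : ∀ p q r t : ℤˣ × ℤˣ, p.1 ≠ 1 → q.2 ≠ 1 → r.2 ≠ r.1 →
      1 = t ∨ p = t ∨ q = t ∨ r = t ∨ p * q = t ∨ p * r = t ∨ q * r = t := by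
    simp only [Prod.ext_iff, Prod.forall]
    decide
  rcases key (ε₁.prod ε₂ x) (ε₁.prod ε₂ y) (ε₁.prod ε₂ z) t hx hy hz with
    h | h | h | h | h | h | h
  · exact ⟨1, (map_one _).trans h⟩
  · exact ⟨x, h⟩
  · exact ⟨y, h⟩
  · exact ⟨z, h⟩
  · exact ⟨x * y, (map_mul _ _ _).trans h⟩
  · exact ⟨x * z, (map_mul _ _ _).trans h⟩
  · exact ⟨y * z, (map_mul _ _ _).trans h⟩

theorem PP_subset {P : Set (G → ℂ)}
    (h1 : ∀ τ : G → ℂ, IsGenChar τ → τ 1 = 0 → τ + conjFun τ ∈ P)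
    (h2 : ∀ (H : Subgroup G) (N : Subgroup ↥H) [N.Normal] (V : FDRep ℂ ↥H),
      V.character 1 = 2 → IsTargetGroup (↥H ⧸ N) → (∀ n : ↥H, n ∈ N → V.ρ n = 1) →
      indChar H (V.character - 1 - detRep V) ∈ P)
    (h3 : ∀ (ι : Type) (s : Finset ι) (n : ι → ℤ) (τ : ι → G → ℂ),
      (∀ i ∈ s, τ i ∈ P) → (∑ i ∈ s, n i • τ i) ∈ P)
    {f : G → ℂ} (hf : f ∈ PP G) : f ∈ P := by
  have hzero : (0 : G → ℂ) ∈ P := by simpa using h3 ℕ ∅ 0 0 (by simp)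
  induction hf using AddSubgroup.closure_induction with
  | mem f hf =>
    obtain ⟨τ, hτ, h0⟩ | @⟨L, _, _, ψ, hψ, ε₁, ε₂⟩ | @⟨L, _, _, ψ, hψ, n, hn, d, hd, χ⟩ := hf
    · exact h1 τ (isGenChar_of_mem_mono hτ) h0
    · by_cases hs : Function.Surjective (ε₁.prod ε₂)
      · convert ind_matrix_mem h2 hψ isTargetGroup_units hs diagUnits using 2
        ext x
        simp [diagUnits, sgn, Matrix.trace_fin_two, Matrix.det_fin_two]
      · have hdeg : ∀ ε : L →* ℤˣ, ind ψ (sgn ε - 1) 1 = 0 := fun ε => by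
          rw [ind_one hψ, Pi.sub_apply, sgn_apply_one, Pi.one_apply, sub_self, mul_zero, mul_zero]
        rcases eq_one_or_eq_of_not_surjective hs with h | h | h
        · simpa [h] using hzero
        · simpa [h] using hzero
        · have hsq : ε₁ * ε₁ = 1 := by ext; simp
          rw [h, hsq, sgn_one]
          have h := h1 _ (isGenChar_of_mem_mono
            (ind_mono hψ (sub_mem (sgn_mem_mono ε₁) one_mem_mono))) (hdeg _)
          rw [conjFun_ind, sub_eq_add_neg, conjFun_add, conjFun_neg, conjFun_sgn, conjFun_one,
            ← map_add] at h
          convert h using 2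
          ring
    · convert ind_matrix_mem h2 hψ (isTargetGroup_dihedralGroup hn) hd (dihMatrix χ) using 2
      ext x
      rcases d x with i | i <;>
        simp [dih, dihMatrix, Matrix.trace_fin_two, Matrix.det_fin_two, ← AddChar.map_add_eq_mul]
      ring
  | zero => exact hzero
  | add a b _ _ ha hb =>
    simpa using h3 Bool Finset.univ 1 (fun i => if i then a else b) (by simp [ha, hb])
  | neg a _ ha => simpa using h3 Unit Finset.univ (-1) (fun _ => a) (by simp [ha])

end PermDet

end

/-- **Theorem 1.2.** Let `G` be a finite group and `𝒫` a set of real-valued generalised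
characters of `G` satisfying (1) `τ + τ̄ ∈ 𝒫` for every generalised character `τ` of degree 0,
(2) `Ind_H^G (τ - 1_H - det τ) ∈ 𝒫` for every subgroup `H` and degree-2 character `τ` of `H`
factoring through a quotient of `H` isomorphic to `C₂ × C₂`, `D₈` or `D_{2p}` (`p` an odd
prime), and (3) closure under `ℤ`-linear combinations.  Then `𝒫` contains every permutation
character of `G` of degree 0 and trivial determinant. -/
theorem statement0 (G : Type) [Group G] [Fintype G] (P : Set (G → ℂ))
    (hP : ∀ f ∈ P, IsGenChar f ∧ ∀ g : G, starRingEnd ℂ (f g) = f g)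
    (h1 : ∀ τ : G → ℂ, IsGenChar τ → τ 1 = 0 → τ + conjFun τ ∈ P)
    (h2 : ∀ (H : Subgroup G) (N : Subgroup ↥H) [N.Normal] (V : FDRep ℂ ↥H),
      V.character 1 = 2 → IsTargetGroup (↥H ⧸ N) → (∀ n : ↥H, n ∈ N → V.ρ n = 1) →
      indChar H (V.character - 1 - detRep V) ∈ P)
    (h3 : ∀ (ι : Type) (s : Finset ι) (n : ι → ℤ) (τ : ι → G → ℂ),
      (∀ i ∈ s, τ i ∈ P) → (∑ i ∈ s, n i • τ i) ∈ P) :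
    ∀ f : G → ℂ, IsPermChar f → f 1 = 0 → HasTrivialDet f → f ∈ P := by
  intro f hf h0 hd
  exact PermDet.PP_subset h1 h2 h3 (PermDet.mem_PP_of_isEvenPerm
    (PermDet.isEvenPerm_of_hasTrivialDet (PermDet.mem_perm_of_isPermChar hf) h0 hd))
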